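/- arXiv:1610.07481 — 2 statements merged into one kernel-verified Lean document; each statement's English description precedes it below -/
import Mathlib

section
/- (Sewing Lemma.) Fix an interval I, a Banach space E and a parameter ζ > 1. Let G be an E-valued map on {(s,u,t) ∈ I³ : s ≤ u ≤ t} such that G lies in the image of δ (i.e. there is a 2-index map B with G_{sut} = B_{st} − B_{su} − B_{ut}) and such that |G_{sut}| ≤ ω(s,t)^ζ for every s ≤ u ≤ t in I, for some regular control ω on I. Then there exists a unique element ΛG ∈ V^{1/ζ}_2(I;E) such that δ(ΛG)_{sut} := (ΛG)_{st} − (ΛG)_{su} − (ΛG)_{ut} = G_{sut} for all s ≤ u ≤ t, and moreover |(ΛG)_{st}| ≤ C_ζ ω(s,t)^ζ for every s ≤ t in I, where C_ζ is a universal constant depending only on ζ. -/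
open MeasureTheory Set Filter

noncomputable section

/-- The set of partition sums `Σ ‖g(t_i, t_{i+1})‖^p` over partitions of `[s,t]`. -/
def partitionSums {E : Type*} [NormedAddCommGroup E] (p s t : ℝ) (g : ℝ → ℝ → E) : Set ℝ :=
  {x | ∃ (n : ℕ) (u : ℕ → ℝ), u 0 = s ∧ u n = t ∧ (∀ i < n, u i < u (i + 1)) ∧
    x = ∑ i ∈ Finset.range n, ‖g (u i) (u (i + 1))‖ ^ p}

/-- `‖g‖^p_{V̄^p_2([s,t];E)}`, the `p`-th power of the `p`-variation norm. -/
def pVarSum {E : Type*} [NormedAddCommGroup E] (p s t : ℝ) (g : ℝ → ℝ → E) : ℝ :=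
  sSup (partitionSums p s t g)

/-- The `p`-variation norm `‖g‖_{V̄^p_2([s,t];E)}`. -/
def pVarNorm {E : Type*} [NormedAddCommGroup E] (p s t : ℝ) (g : ℝ → ℝ → E) : ℝ :=
  (pVarSum p s t g) ^ (1 / p)

/-- A control on the interval `[a,b]`: nonnegative and superadditive. -/
def IsControl (a b : ℝ) (ω : ℝ → ℝ → ℝ) : Prop :=
  (∀ s t, a ≤ s → s ≤ t → t ≤ b → 0 ≤ ω s t) ∧
  (∀ s u t, a ≤ s → s ≤ u → u ≤ t → t ≤ b → ω s u + ω u t ≤ ω s t)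

/-- A regular control: moreover `ω(s,t) → 0` as `|t - s| → 0`. -/
def IsRegularControl (a b : ℝ) (ω : ℝ → ℝ → ℝ) : Prop :=
  IsControl a b ω ∧
  ∀ ε > 0, ∃ δ > 0, ∀ s t, a ≤ s → s ≤ t → t ≤ b → t - s < δ → ω s t < ε

/-- `g ∈ V^p_2([a,b];E)` : finite `p`-variation whose associated control is regular. -/
def MemVp2 {E : Type*} [NormedAddCommGroup E] (p a b : ℝ) (g : ℝ → ℝ → E) : Prop :=
  (∀ s t, a ≤ s → s ≤ t → t ≤ b → BddAbove (partitionSums p s t g)) ∧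
  IsRegularControl a b (fun s t => pVarSum p s t g)

/-- `y ∈ V^p_1([a,b];E)` for a path `y`. -/
def MemVp1 {E : Type*} [NormedAddCommGroup E] (p a b : ℝ) (y : ℝ → E) : Prop :=
  MemVp2 p a b (fun s t => y t - y s)

variable {E : Type*} [NormedAddCommGroup E]

/-- The constant in the sewing bound with exponent `ζ`. -/
def sewingConst (ζ : ℝ) : ℝ := 2 / (1 - 2 ^ (1 - ζ))

lemma two_rpow_one_sub_lt_one {ζ : ℝ} (hζ : 1 < ζ) : (2 : ℝ) ^ (1 - ζ) < 1 :=
  Real.rpow_lt_one_of_one_lt_of_neg one_lt_two (by linarith)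

lemma sewingConst_pos {ζ : ℝ} (hζ : 1 < ζ) : 0 < sewingConst ζ :=
  div_pos two_pos (sub_pos.2 (two_rpow_one_sub_lt_one hζ))

lemma sewingConst_fixed {ζ : ℝ} (hζ : 1 < ζ) :
    2 * (sewingConst ζ * (1 / 2) ^ ζ) + 2 = sewingConst ζ := by
  have h := sub_pos.2 (two_rpow_one_sub_lt_one hζ)
  have h2 : (2 : ℝ) ^ (1 - ζ) = 2 * (1 / 2) ^ ζ := by
    rw [Real.rpow_sub two_pos, Real.rpow_one, Real.div_rpow zero_le_one zero_le_two,
      Real.one_rpow]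
    ring
  have h3 : sewingConst ζ * (1 - 2 ^ (1 - ζ)) = 2 := div_mul_cancel₀ _ h.ne'
  rw [h2] at h3
  linarith

section Discrete

variable {w : ℕ → ℕ → ℝ}

lemma superadditive_self_eq_zero (hw0 : ∀ i k, i ≤ k → 0 ≤ w i k)
    (hw : ∀ i j k, i ≤ j → j ≤ k → w i j + w j k ≤ w i k) (i : ℕ) : w i i = 0 := by
  linarith [hw0 i i le_rfl, hw i i i le_rfl le_rfl]

/-- A superadditive function splits an index range into two halves and one elementary step. -/
lemma exists_superadditive_bisection (hw0 : ∀ i k, i ≤ k → 0 ≤ w i k)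
    (hw : ∀ i j k, i ≤ j → j ≤ k → w i j + w j k ≤ w i k) {i k : ℕ} (hik : i < k) :
    ∃ l, i ≤ l ∧ l < k ∧ w i l ≤ w i k / 2 ∧ w (l + 1) k ≤ w i k / 2 := by
  classical
  have hex : ∃ l, i ≤ l ∧ w (l + 1) k ≤ w i k / 2 := by
    refine ⟨k - 1, by omega, ?_⟩
    rw [Nat.sub_add_cancel (by omega), superadditive_self_eq_zero hw0 hw]
    linarith [hw0 i k hik.le]
  obtain ⟨hl, hlk⟩ := Nat.find_spec hex
  have hlt : Nat.find hex < k := by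
    have : Nat.find hex ≤ k - 1 := Nat.find_min' hex ⟨by omega, by
      rw [Nat.sub_add_cancel (by omega), superadditive_self_eq_zero hw0 hw]
      linarith [hw0 i k hik.le]⟩
    omega
  refine ⟨Nat.find hex, hl, hlt, ?_, hlk⟩
  rcases hl.eq_or_lt with h | h
  · rw [← h, superadditive_self_eq_zero hw0 hw]
    linarith [hw0 i k hik.le]
  · have hmin := Nat.find_min hex (m := Nat.find hex - 1) (by omega)
    rw [not_and, Nat.sub_add_cancel (by omega), not_le] at hmin
    linarith [hmin (by omega), hw i (Nat.find hex) k hl hlt.le]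

lemma norm_sub_sum_Ico_le {ζ : ℝ} (hζ : 1 < ζ) (hw0 : ∀ i k, i ≤ k → 0 ≤ w i k)
    (hw : ∀ i j k, i ≤ j → j ≤ k → w i j + w j k ≤ w i k) {B : ℕ → ℕ → E}
    (hB : ∀ i j k, i ≤ j → j ≤ k → ‖B i k - B i j - B j k‖ ≤ w i k ^ ζ) {i k : ℕ} (hik : i ≤ k) :
    ‖B i k - ∑ j ∈ Finset.Ico i k, B j (j + 1)‖ ≤ sewingConst ζ * w i k ^ ζ := by
  have hζ0 : ζ ≠ 0 := by linarith
  induction hn : k - i using Nat.strong_induction_on generalizing i k with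
  | _ n ih =>
  rcases hik.eq_or_lt with rfl | hlt
  · have := hB i i i le_rfl le_rfl
    rw [superadditive_self_eq_zero hw0 hw, Real.zero_rpow hζ0] at this
    simpa [superadditive_self_eq_zero hw0 hw, Real.zero_rpow hζ0] using this
  · obtain ⟨l, hil, hlk, h1, h2⟩ := exists_superadditive_bisection hw0 hw hlt
    have hhalf : ∀ x, 0 ≤ x → x ≤ w i k / 2 →
        sewingConst ζ * x ^ ζ ≤ sewingConst ζ * (1 / 2) ^ ζ * w i k ^ ζ := by
      intro x hx hxk
      rw [mul_assoc, ← Real.mul_rpow (by norm_num) (hw0 i k hik)]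
      refine mul_le_mul_of_nonneg_left (Real.rpow_le_rpow hx (by linarith) (by linarith))
        (sewingConst_pos hζ).le
    have e1 := (ih (l - i) (by omega) hil rfl).trans (hhalf _ (hw0 i l hil) h1)
    have e2 := (ih (k - (l + 1)) (by omega) (i := l + 1) (k := k) hlk rfl).trans
      (hhalf _ (hw0 _ k hlk) h2)
    have e3 := hB i l k hil hlk.le
    have e4 := (hB l (l + 1) k l.le_succ hlk).trans
      (Real.rpow_le_rpow (hw0 l k hlk.le)
        (by linarith [hw i l k hil hlk.le, hw0 i l hil] : w l k ≤ w i k) (by linarith : 0 ≤ ζ))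
    have hsum : ∑ j ∈ Finset.Ico i k, B j (j + 1) = ∑ j ∈ Finset.Ico i l, B j (j + 1) +
        (B l (l + 1) + ∑ j ∈ Finset.Ico (l + 1) k, B j (j + 1)) := by
      rw [← Finset.sum_Ico_consecutive _ hil hlk.le, Finset.sum_eq_sum_Ico_succ_bot hlk]
    have hsplit : B i k - ∑ j ∈ Finset.Ico i k, B j (j + 1) =
        (B i l - ∑ j ∈ Finset.Ico i l, B j (j + 1)) +
        (B (l + 1) k - ∑ j ∈ Finset.Ico (l + 1) k, B j (j + 1)) +
        (B i k - B i l - B l k) + (B l k - B l (l + 1) - B (l + 1) k) := by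
      rw [hsum]; abel
    rw [hsplit]
    refine norm_add₄_le.trans ?_
    calc _ ≤ (2 * (sewingConst ζ * (1 / 2) ^ ζ) + 2) * w i k ^ ζ := by linarith
      _ = _ := by rw [sewingConst_fixed hζ]

lemma sum_range_le_of_superadditive (hw0 : ∀ i k, i ≤ k → 0 ≤ w i k)
    (hw : ∀ i j k, i ≤ j → j ≤ k → w i j + w j k ≤ w i k) (n : ℕ) :
    ∑ i ∈ Finset.range n, w i (i + 1) ≤ w 0 n := by
  induction n with
  | zero => simpa using hw0 0 0 le_rfl
  | succ n ih =>
    rw [Finset.sum_range_succ]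
    linarith [hw 0 n (n + 1) n.zero_le n.le_succ]

end Discrete

section Control

variable {a b : ℝ} {ω : ℝ → ℝ → ℝ}

lemma IsControl.self_eq_zero (h : IsControl a b ω) {s : ℝ} (has : a ≤ s) (hsb : s ≤ b) :
    ω s s = 0 := by
  linarith [h.1 s s has le_rfl hsb, h.2 s s s has le_rfl le_rfl hsb]

lemma IsControl.mono_interval (h : IsControl a b ω) {s s' t' t : ℝ} (has : a ≤ s) (hs : s ≤ s')
    (hst : s' ≤ t') (ht : t' ≤ t) (htb : t ≤ b) : ω s' t' ≤ ω s t := by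
  linarith [h.2 s s' t has hs (hst.trans ht) htb, h.2 s' t' t (has.trans hs) hst ht htb,
    h.1 s s' has hs (by linarith), h.1 t' t (by linarith) ht htb]

lemma IsRegularControl.restrict (h : IsRegularControl a b ω) {s t : ℝ} (has : a ≤ s)
    (htb : t ≤ b) : IsRegularControl s t ω := by
  refine ⟨⟨fun u v hu huv hv => h.1.1 u v (has.trans hu) huv (hv.trans htb),
    fun u v w hu huv hvw hw => h.1.2 u v w (has.trans hu) huv hvw (hw.trans htb)⟩, ?_⟩
  intro ε hε
  obtain ⟨δ, hδ, H⟩ := h.2 ε hε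
  exact ⟨δ, hδ, fun u v hu huv hv => H u v (has.trans hu) huv (hv.trans htb)⟩

/-- The subdivision points of `[a,b]` into `N` intervals of equal length. -/
def uniformPoint (a b : ℝ) (N i : ℕ) : ℝ := a + (b - a) * (i / N)

lemma uniformPoint_zero (a b : ℝ) (N : ℕ) : uniformPoint a b N 0 = a := by
  simp [uniformPoint]

lemma uniformPoint_self (a b : ℝ) {N : ℕ} (hN : N ≠ 0) : uniformPoint a b N N = b := by
  simp [uniformPoint, hN]

lemma uniformPoint_mono (hab : a ≤ b) (N : ℕ) : Monotone (uniformPoint a b N) := by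
  intro i j hij
  unfold uniformPoint
  have := sub_nonneg.2 hab
  gcongr

lemma uniformPoint_mul (a b : ℝ) (N : ℕ) {M : ℕ} (hM : M ≠ 0) (i : ℕ) :
    uniformPoint a b (N * M) (i * M) = uniformPoint a b N i := by
  have : (M : ℝ) ≠ 0 := by exact_mod_cast hM
  simp only [uniformPoint, Nat.cast_mul]
  rw [mul_div_mul_right _ _ this]

lemma left_le_uniformPoint (hab : a ≤ b) (N i : ℕ) : a ≤ uniformPoint a b N i :=
  (uniformPoint_zero a b N).symm.trans_le (uniformPoint_mono hab N i.zero_le)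

lemma uniformPoint_le_right (hab : a ≤ b) {N i : ℕ} (hN : N ≠ 0) (hi : i ≤ N) :
    uniformPoint a b N i ≤ b :=
  (uniformPoint_mono hab N hi).trans_eq (uniformPoint_self a b hN)

lemma IsControl.sum_le (h : IsControl a b ω) {u : ℕ → ℝ} (hu : Monotone u) (n : ℕ)
    (ha : a ≤ u 0) (hb : u n ≤ b) :
    ∑ i ∈ Finset.range n, ω (u i) (u (i + 1)) ≤ ω (u 0) (u n) := by
  have key := sum_range_le_of_superadditive (w := fun i j => ω (u (min i n)) (u (min j n)))
    (fun i k hik => h.1 _ _ (ha.trans (hu (Nat.zero_le _))) (hu (by omega))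
      ((hu (min_le_right _ _)).trans hb))
    (fun i j k hij hjk => h.2 _ _ _ (ha.trans (hu (Nat.zero_le _))) (hu (by omega))
      (hu (by omega)) ((hu (min_le_right _ _)).trans hb)) n
  simp only [Nat.zero_min, min_self] at key
  refine (Finset.sum_le_sum fun i hi => ?_).trans key
  have := Finset.mem_range.1 hi
  rw [min_eq_left (by omega), min_eq_left (by omega)]

/-- The Riemann-type sums of `ω ^ ζ` over uniform subdivisions vanish in the limit. -/
lemma IsRegularControl.tendsto_sum_rpow (h : IsRegularControl a b ω) (hab : a ≤ b) {ζ : ℝ}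
    (hζ : 1 < ζ) :
    Tendsto (fun N : ℕ => ∑ i ∈ Finset.range (N + 1),
      ω (uniformPoint a b (N + 1) i) (uniformPoint a b (N + 1) (i + 1)) ^ ζ)
      atTop (nhds 0) := by
  have hcell : ∀ N i, i < N + 1 →
      0 ≤ ω (uniformPoint a b (N + 1) i) (uniformPoint a b (N + 1) (i + 1)) := fun N i hi =>
    h.1.1 _ _ (left_le_uniformPoint hab _ _) (uniformPoint_mono hab _ i.le_succ)
      (uniformPoint_le_right hab N.succ_ne_zero hi)
  have hω := h.1.1 a b le_rfl hab le_rfl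
  rw [Metric.tendsto_atTop]
  intro ε hε
  set η : ℝ := (ε / (ω a b + 1)) ^ (ζ - 1)⁻¹ with hη
  have hq : 0 < ε / (ω a b + 1) := by positivity
  have hηpos : 0 < η := Real.rpow_pos_of_pos hq _
  have hηpow : η ^ (ζ - 1) = ε / (ω a b + 1) :=
    Real.rpow_inv_rpow hq.le (by linarith)
  obtain ⟨δ, hδ, H⟩ := h.2 η hηpos
  obtain ⟨N₀, hN₀⟩ := exists_nat_gt ((b - a) / δ)
  refine ⟨N₀, fun N hN => ?_⟩
  have hNpos : (0 : ℝ) < (N : ℝ) + 1 := by positivity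
  have hmesh : (b - a) / (N + 1) < δ := by
    rw [div_lt_iff₀ hδ] at hN₀
    rw [div_lt_iff₀ hNpos]
    have : (N₀ : ℝ) ≤ N := by exact_mod_cast hN
    nlinarith
  have hbound : ∀ i ∈ Finset.range (N + 1),
      ω (uniformPoint a b (N + 1) i) (uniformPoint a b (N + 1) (i + 1)) ^ ζ ≤
        ε / (ω a b + 1) * ω (uniformPoint a b (N + 1) i) (uniformPoint a b (N + 1) (i + 1)) := by
    intro i hi
    have hi := Finset.mem_range.1 hi
    have h0 := hcell N i hi
    have hlt := H _ _ (left_le_uniformPoint hab (N + 1) i) (uniformPoint_mono hab _ i.le_succ)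
      (uniformPoint_le_right hab N.succ_ne_zero hi) (by
        refine lt_of_eq_of_lt ?_ hmesh
        simp only [uniformPoint, Nat.cast_add, Nat.cast_one, Nat.succ_eq_add_one]
        field_simp
        ring)
    calc _ = ω (uniformPoint a b (N + 1) i) (uniformPoint a b (N + 1) (i + 1)) ^ (ζ - 1 + 1) := by
          rw [sub_add_cancel]
      _ = ω (uniformPoint a b (N + 1) i) (uniformPoint a b (N + 1) (i + 1)) ^ (ζ - 1) *
          ω (uniformPoint a b (N + 1) i) (uniformPoint a b (N + 1) (i + 1)) := by
          rw [Real.rpow_add_one' h0 (by linarith)]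
      _ ≤ _ := by
          rw [← hηpow]
          exact mul_le_mul_of_nonneg_right (Real.rpow_le_rpow h0 hlt.le (by linarith)) h0
  have hsum := h.1.sum_le (uniformPoint_mono hab (N + 1)) (N + 1)
    (left_le_uniformPoint hab _ _) (uniformPoint_le_right hab N.succ_ne_zero le_rfl)
  rw [uniformPoint_zero, uniformPoint_self a b N.succ_ne_zero] at hsum
  have hnn : 0 ≤ ∑ i ∈ Finset.range (N + 1),
      ω (uniformPoint a b (N + 1) i) (uniformPoint a b (N + 1) (i + 1)) ^ ζ :=
    Finset.sum_nonneg fun i hi => Real.rpow_nonneg (hcell N i (Finset.mem_range.1 hi)) _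
  rw [Real.dist_eq, sub_zero, abs_of_nonneg hnn]
  calc _ ≤ ε / (ω a b + 1) * ω a b := by
        refine (Finset.sum_le_sum hbound).trans ?_
        rw [← Finset.mul_sum]
        exact mul_le_mul_of_nonneg_left hsum hq.le
    _ < ε := by
        rw [div_mul_eq_mul_div, div_lt_iff₀ (by positivity)]
        nlinarith

end Control

section Variation

variable {a b p : ℝ} {ω : ℝ → ℝ → ℝ} {g : ℝ → ℝ → E}

lemma partitionSums_nonneg {s t x : ℝ} (hx : x ∈ partitionSums p s t g) : 0 ≤ x := by
  obtain ⟨n, u, -, -, -, rfl⟩ := hx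
  exact Finset.sum_nonneg fun i _ => Real.rpow_nonneg (norm_nonneg _) _

lemma partitionSums_self_zero (s : ℝ) : (0 : ℝ) ∈ partitionSums p s s g :=
  ⟨0, fun _ => s, rfl, rfl, by simp, by simp⟩

lemma norm_rpow_mem_partitionSums {s t : ℝ} (hst : s < t) :
    ‖g s t‖ ^ p ∈ partitionSums p s t g := by
  refine ⟨1, fun i => if i = 0 then s else t, by simp, by simp, ?_, by simp⟩
  intro i hi
  obtain rfl : i = 0 := by omega
  simpa using hst

lemma partitionSums_nonempty {s t : ℝ} (hst : s ≤ t) : (partitionSums p s t g).Nonempty := by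
  rcases hst.eq_or_lt with rfl | h
  · exact ⟨_, partitionSums_self_zero s⟩
  · exact ⟨_, norm_rpow_mem_partitionSums h⟩

lemma add_mem_partitionSums {s r t x y : ℝ} (hx : x ∈ partitionSums p s r g)
    (hy : y ∈ partitionSums p r t g) : x + y ∈ partitionSums p s t g := by
  obtain ⟨n, u, hu0, hun, hu, rfl⟩ := hx
  obtain ⟨m, v, hv0, hvm, hv, rfl⟩ := hy
  have h1 : ∀ i ≤ n, (if i ≤ n then u i else v (i - n)) = u i := fun i hi => if_pos hi
  have h2 : ∀ i, (if n + i ≤ n then u (n + i) else v (n + i - n)) = v i := by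
    intro i
    rcases i.eq_zero_or_pos with rfl | hi
    · simp [hun, hv0]
    · rw [if_neg (by omega), Nat.add_sub_cancel_left]
  refine ⟨n + m, fun i => if i ≤ n then u i else v (i - n), ?_, ?_, ?_, ?_⟩
  · simpa using hu0
  · simp only [h2, hvm]
  · intro i hi
    rcases lt_or_ge i n with h | h
    · simp only [h1 i h.le, h1 (i + 1) h]
      exact hu i h
    · obtain ⟨j, rfl⟩ := Nat.exists_eq_add_of_le h
      simp only [add_assoc, h2]
      exact hv j (by omega)
  · rw [Finset.sum_range_add]
    congr 1
    · refine Finset.sum_congr rfl fun i hi => ?_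
      have hi := Finset.mem_range.1 hi
      simp only [h1 i hi.le, h1 (i + 1) hi]
    · refine Finset.sum_congr rfl fun i _ => ?_
      simp only [add_assoc, h2]

lemma partitionSums_le (hω : IsControl a b ω) {K : ℝ} (hK : 0 ≤ K)
    (hg : ∀ s t, a ≤ s → s ≤ t → t ≤ b → ‖g s t‖ ^ p ≤ K * ω s t) {s t x : ℝ} (has : a ≤ s)
    (htb : t ≤ b) (hx : x ∈ partitionSums p s t g) : x ≤ K * ω s t := by
  obtain ⟨n, u, rfl, rfl, hu, rfl⟩ := hx
  set v : ℕ → ℝ := fun i => u (min i n) with hv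
  have hvm : Monotone v := by
    refine monotone_nat_of_le_succ fun i => ?_
    rcases lt_or_ge i n with h | h
    · simp only [hv, min_eq_left h.le, min_eq_left (Nat.succ_le_of_lt h)]
      exact (hu i h).le
    · simp only [hv, min_eq_right h, min_eq_right (h.trans i.le_succ), le_refl]
  have hv0 : v 0 = u 0 := by simp [hv]
  have hvn : v n = u n := by simp [hv]
  rw [← hv0] at has
  rw [← hvn] at htb
  rw [← hv0, ← hvn]
  calc _ ≤ ∑ i ∈ Finset.range n, K * ω (v i) (v (i + 1)) := by
        refine Finset.sum_le_sum fun i hi => ?_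
        have hi := Finset.mem_range.1 hi
        have e1 : u i = v i := by simp [hv, hi.le]
        have e2 : u (i + 1) = v (i + 1) := by simp [hv, Nat.succ_le_of_lt hi]
        rw [e1, e2]
        exact hg _ _ (has.trans (hvm i.zero_le)) (hvm i.le_succ) ((hvm hi).trans htb)
    _ ≤ _ := by
        rw [← Finset.mul_sum]
        exact mul_le_mul_of_nonneg_left (hω.sum_le hvm n has htb) hK

/-- A two-index map dominated by a regular control has regular finite variation. -/
lemma memVp2_of_le (hω : IsRegularControl a b ω) {K : ℝ} (hK : 0 ≤ K)
    (hg : ∀ s t, a ≤ s → s ≤ t → t ≤ b → ‖g s t‖ ^ p ≤ K * ω s t) : MemVp2 p a b g := by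
  have hbdd : ∀ s t, a ≤ s → s ≤ t → t ≤ b → BddAbove (partitionSums p s t g) :=
    fun s t has _ htb => ⟨K * ω s t, fun x hx => partitionSums_le hω.1 hK hg has htb hx⟩
  refine ⟨hbdd, ⟨fun s t _ _ _ => Real.sSup_nonneg fun x => partitionSums_nonneg, ?_⟩, ?_⟩
  · intro s u t has hsu hut htb
    unfold pVarSum
    rw [← le_sub_iff_add_le]
    refine csSup_le (partitionSums_nonempty hsu) fun x hx => ?_
    rw [le_sub_comm]
    refine csSup_le (partitionSums_nonempty hut) fun y hy => ?_
    rw [le_sub_iff_add_le']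
    exact le_csSup (hbdd s t has (hsu.trans hut) htb) (add_mem_partitionSums hx hy)
  · intro ε hε
    obtain ⟨δ, hδ, H⟩ := hω.2 (ε / (K + 1)) (by positivity)
    refine ⟨δ, hδ, fun s t has hst htb hlt => ?_⟩
    have h1 : pVarSum p s t g ≤ K * ω s t :=
      csSup_le (partitionSums_nonempty hst) fun x hx => partitionSums_le hω.1 hK hg has htb hx
    have h2 := H s t has hst htb hlt
    rw [lt_div_iff₀ (by positivity)] at h2
    have h3 := hω.1.1 s t has hst htb
    change pVarSum p s t g < ε
    nlinarith

lemma MemVp2.norm_le_pVarSum_rpow {ζ : ℝ} (hζ : 1 < ζ) (hg : MemVp2 (1 / ζ) a b g) {s t : ℝ}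
    (has : a ≤ s) (hst : s ≤ t) (htb : t ≤ b) (h0 : g s s = 0) :
    ‖g s t‖ ≤ pVarSum (1 / ζ) s t g ^ ζ := by
  rcases hst.eq_or_lt with rfl | hlt
  · rw [h0, norm_zero]
    exact Real.rpow_nonneg (hg.2.1.1 s s has le_rfl htb) _
  · have h1 : ‖g s t‖ ^ (1 / ζ) ≤ pVarSum (1 / ζ) s t g :=
      le_csSup (hg.1 s t has hst htb) (norm_rpow_mem_partitionSums hlt)
    calc ‖g s t‖ = (‖g s t‖ ^ (1 / ζ)) ^ ζ := by
          rw [one_div, Real.rpow_inv_rpow (norm_nonneg _) (by linarith)]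
      _ ≤ _ := Real.rpow_le_rpow (Real.rpow_nonneg (norm_nonneg _) _) h1 (by linarith)

end Variation

section Sewing

variable {a b ζ : ℝ} {ω : ℝ → ℝ → ℝ} {B : ℝ → ℝ → E}

lemma germ_self_eq_zero (hζ : 1 < ζ) (hω : IsControl a b ω)
    (hB : ∀ s u t, a ≤ s → s ≤ u → u ≤ t → t ≤ b → ‖B s t - B s u - B u t‖ ≤ ω s t ^ ζ)
    {s : ℝ} (has : a ≤ s) (hsb : s ≤ b) : B s s = 0 := by
  have h := hB s s s has le_rfl le_rfl hsb
  rw [hω.self_eq_zero has hsb, Real.zero_rpow (by linarith)] at h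
  simpa using h

lemma norm_sub_sum_germ_le (hζ : 1 < ζ) (hω : IsControl a b ω)
    (hB : ∀ s u t, a ≤ s → s ≤ u → u ≤ t → t ≤ b → ‖B s t - B s u - B u t‖ ≤ ω s t ^ ζ)
    {u : ℕ → ℝ} (hu : Monotone u) (ha : ∀ i, a ≤ u i) (hb : ∀ i, u i ≤ b) {i k : ℕ}
    (hik : i ≤ k) :
    ‖B (u i) (u k) - ∑ j ∈ Finset.Ico i k, B (u j) (u (j + 1))‖ ≤
      sewingConst ζ * ω (u i) (u k) ^ ζ :=
  norm_sub_sum_Ico_le (w := fun i k => ω (u i) (u k)) (B := fun i k => B (u i) (u k)) hζ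
    (fun i k hik => hω.1 _ _ (ha i) (hu hik) (hb k))
    (fun i _ k hij hjk => hω.2 _ _ _ (ha i) (hu hij) (hu hjk) (hb k))
    (fun i _ k hij hjk => hB _ _ _ (ha i) (hu hij) (hu hjk) (hb k)) hik

/-- The Riemann-type sum of the germ `B` over the uniform subdivision stopped at time `t`. -/
def stoppedSum (B : ℝ → ℝ → E) (a b : ℝ) (N : ℕ) (t : ℝ) : E :=
  ∑ i ∈ Finset.range N, B (min (uniformPoint a b N i) t) (min (uniformPoint a b N (i + 1)) t)

/-- The mesh error `∑ ω(pᵢ, pᵢ₊₁) ^ ζ` of the uniform subdivision. -/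
def meshError (ω : ℝ → ℝ → ℝ) (a b ζ : ℝ) (N : ℕ) : ℝ :=
  ∑ i ∈ Finset.range N, ω (uniformPoint a b N i) (uniformPoint a b N (i + 1)) ^ ζ

lemma sum_range_mul_eq_sum_Ico (f : ℕ → E) (N M : ℕ) :
    ∑ i ∈ Finset.range (N * M), f i =
      ∑ i ∈ Finset.range N, ∑ j ∈ Finset.Ico (i * M) ((i + 1) * M), f j := by
  induction N with
  | zero => simp
  | succ n ih =>
    rw [Finset.sum_range_succ, ← ih, Finset.sum_range_add_sum_Ico]
    exact Nat.mul_le_mul_right M n.le_succ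

lemma control_min_rpow_le (hζ : 1 < ζ) (hω : IsControl a b ω) {q r t : ℝ} (haq : a ≤ q)
    (hqr : q ≤ r) (hrb : r ≤ b) (hat : a ≤ t) (htb : t ≤ b) :
    ω (min q t) (min r t) ^ ζ ≤ ω q r ^ ζ := by
  refine Real.rpow_le_rpow (hω.1 _ _ (le_min haq hat) (min_le_min_right t hqr)
    ((min_le_right _ _).trans htb)) ?_ (by linarith)
  rcases le_total q t with h | h
  · rw [min_eq_left h]
    exact hω.mono_interval haq le_rfl (le_min hqr h) (min_le_left _ _) hrb
  · rw [min_eq_right h, min_eq_right (h.trans hqr), hω.self_eq_zero hat htb]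
    exact hω.1 q r haq hqr hrb

lemma norm_stoppedSum_sub_refine_le (hζ : 1 < ζ) (hab : a ≤ b) (hω : IsControl a b ω)
    (hB : ∀ s u t, a ≤ s → s ≤ u → u ≤ t → t ≤ b → ‖B s t - B s u - B u t‖ ≤ ω s t ^ ζ)
    {N M : ℕ} (hN : N ≠ 0) (hM : M ≠ 0) {t : ℝ} (hat : a ≤ t) (htb : t ≤ b) :
    ‖stoppedSum B a b N t - stoppedSum B a b (N * M) t‖ ≤
      sewingConst ζ * meshError ω a b ζ N := by
  unfold stoppedSum meshError
  rw [sum_range_mul_eq_sum_Ico, ← Finset.sum_sub_distrib, Finset.mul_sum]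
  refine norm_sum_le_of_le _ fun i hi => ?_
  have hi := Finset.mem_range.1 hi
  have h := norm_sub_sum_germ_le hζ hω hB (u := fun j => min (uniformPoint a b (N * M) j) t)
    (fun j k hjk => min_le_min_right t (uniformPoint_mono hab _ hjk))
    (fun _ => le_min (left_le_uniformPoint hab _ _) hat)
    (fun _ => (min_le_right _ _).trans htb)
    (Nat.mul_le_mul_right M i.le_succ)
  simp only [Nat.succ_eq_add_one, uniformPoint_mul a b N hM] at h
  refine h.trans (mul_le_mul_of_nonneg_left ?_ (sewingConst_pos hζ).le)
  exact control_min_rpow_le hζ hω (left_le_uniformPoint hab _ _)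
    (uniformPoint_mono hab _ i.le_succ) (uniformPoint_le_right hab hN hi) hat htb

lemma norm_cell_split_le (hζ : 1 < ζ) (hω : IsControl a b ω)
    (hB : ∀ s u t, a ≤ s → s ≤ u → u ≤ t → t ≤ b → ‖B s t - B s u - B u t‖ ≤ ω s t ^ ζ)
    {q r s : ℝ} (haq : a ≤ q) (hqr : q ≤ r) (hrb : r ≤ b) (has : a ≤ s) (hsb : s ≤ b) :
    ‖B q r - B (min q s) (min r s) - B (max q s) (max r s)‖ ≤ ω q r ^ ζ := by
  have h0 := germ_self_eq_zero hζ hω hB has hsb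
  have hnn : 0 ≤ ω q r ^ ζ := Real.rpow_nonneg (hω.1 q r haq hqr hrb) _
  rcases le_total s q with h | h
  · simpa [h, h.trans hqr, h0] using hnn
  · rcases le_total r s with h' | h'
    · simpa [h, h', h0] using hnn
    · simpa [h, h'] using hB q s r haq h h' hrb

lemma norm_sub_stoppedSum_sub_le (hζ : 1 < ζ) (hab : a ≤ b) (hω : IsControl a b ω)
    (hB : ∀ s u t, a ≤ s → s ≤ u → u ≤ t → t ≤ b → ‖B s t - B s u - B u t‖ ≤ ω s t ^ ζ)
    {N : ℕ} (hN : N ≠ 0) {s t : ℝ} (has : a ≤ s) (hst : s ≤ t) (htb : t ≤ b) :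
    ‖B s t - (stoppedSum B a b N t - stoppedSum B a b N s)‖ ≤
      sewingConst ζ * ω s t ^ ζ + meshError ω a b ζ N := by
  have hat := has.trans hst
  have hsb := hst.trans htb
  set v : ℕ → ℝ := fun i => max (min (uniformPoint a b N i) t) s with hv
  have hvm : Monotone v := fun i j hij =>
    max_le_max_right s (min_le_min_right t (uniformPoint_mono hab N hij))
  have h1 := norm_sub_sum_germ_le hζ hω hB hvm (fun i => has.trans (le_max_right _ _))
    (fun i => max_le ((min_le_right _ _).trans htb) hsb) N.zero_le
  have hv0 : v 0 = s := by simp [hv, uniformPoint_zero, has]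
  have hvN : v N = t := by simp [hv, uniformPoint_self a b hN, htb, hst]
  rw [hv0, hvN, ← Finset.range_eq_Ico] at h1
  have h2 : ‖∑ i ∈ Finset.range N, B (v i) (v (i + 1)) -
      (stoppedSum B a b N t - stoppedSum B a b N s)‖ ≤ meshError ω a b ζ N := by
    unfold stoppedSum meshError
    rw [← Finset.sum_sub_distrib, ← Finset.sum_sub_distrib]
    refine norm_sum_le_of_le _ fun i hi => ?_
    have hi := Finset.mem_range.1 hi
    have hap := left_le_uniformPoint hab N i
    have hpp := uniformPoint_mono hab N i.le_succ
    have hpb := uniformPoint_le_right hab hN hi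
    have h := (norm_cell_split_le hζ hω hB (le_min hap hat) (min_le_min_right t hpp)
      ((min_le_right _ _).trans htb) has hsb).trans
      (control_min_rpow_le hζ hω hap hpp hpb hat htb)
    rw [min_assoc, min_assoc, min_eq_right hst, ← norm_neg] at h
    refine (congrArg norm ?_).trans_le h
    simp only [hv, Nat.succ_eq_add_one]
    abel
  have := norm_add_le_of_le h1 h2
  rwa [sub_add_sub_cancel] at this

/-- A germ with controlled defect is close to the increments of a path. -/
lemma exists_path_norm_sub_le [CompleteSpace E] (hζ : 1 < ζ) (hab : a ≤ b)
    (hω : IsRegularControl a b ω)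
    (hB : ∀ s u t, a ≤ s → s ≤ u → u ≤ t → t ≤ b → ‖B s t - B s u - B u t‖ ≤ ω s t ^ ζ) :
    ∃ y : ℝ → E, ∀ s t, a ≤ s → s ≤ t → t ≤ b →
      ‖B s t - (y t - y s)‖ ≤ sewingConst ζ * ω s t ^ ζ := by
  have herr : Tendsto (fun N : ℕ => meshError ω a b ζ (N + 1)) atTop (nhds 0) :=
    hω.tendsto_sum_rpow hab hζ
  have hlim : ∀ t, ∃ y, a ≤ t → t ≤ b →
      Tendsto (fun N : ℕ => stoppedSum B a b (N + 1) t) atTop (nhds y) := by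
    intro t
    by_cases ht : a ≤ t ∧ t ≤ b
    · obtain ⟨hat, htb⟩ := ht
      have hcauchy : CauchySeq fun N : ℕ => stoppedSum B a b (N + 1) t := by
        rw [Metric.cauchySeq_iff']
        intro ε hε
        have hC : Tendsto (fun N : ℕ => sewingConst ζ * meshError ω a b ζ (N + 1)) atTop
            (nhds 0) := by simpa using herr.const_mul (sewingConst ζ)
        obtain ⟨N₀, hN₀⟩ := eventually_atTop.1 (hC.eventually_lt_const (half_pos hε))
        refine ⟨N₀, fun N hN => ?_⟩
        have e1 := norm_stoppedSum_sub_refine_le hζ hab hω.1 hB N.succ_ne_zero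
          N₀.succ_ne_zero hat htb
        have e2 := norm_stoppedSum_sub_refine_le hζ hab hω.1 hB N₀.succ_ne_zero
          N.succ_ne_zero hat htb
        rw [mul_comm N₀.succ, ← dist_eq_norm] at e2
        rw [← dist_eq_norm] at e1
        exact (dist_triangle_right _ _ _).trans_lt
          ((add_lt_add (e1.trans_lt (hN₀ N hN)) (e2.trans_lt (hN₀ N₀ le_rfl))).trans_eq
            (add_halves ε))
      obtain ⟨y, hy⟩ := cauchySeq_tendsto_of_complete hcauchy
      exact ⟨y, fun _ _ => hy⟩
    · exact ⟨0, fun h1 h2 => (ht ⟨h1, h2⟩).elim⟩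
  choose y hy using hlim
  refine ⟨y, fun s t has hst htb => ?_⟩
  have h1 := ((hy t (has.trans hst) htb).sub (hy s has (hst.trans htb))).const_sub (B s t)
  have h2 := herr.const_add (sewingConst ζ * ω s t ^ ζ)
  rw [add_zero] at h2
  exact le_of_tendsto_of_tendsto' h1.norm h2 fun N =>
    norm_sub_stoppedSum_sub_le hζ hab hω.1 hB N.succ_ne_zero has hst htb

/-- An additive two-index map dominated by powers `ζ > 1` of regular controls vanishes. -/
lemma eq_zero_of_additive_of_norm_le (hζ : 1 < ζ) {ω' : ℝ → ℝ → ℝ} (hω : IsRegularControl a b ω)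
    (hω' : IsRegularControl a b ω') {h : ℝ → ℝ → E}
    (hadd : ∀ s u t, a ≤ s → s ≤ u → u ≤ t → t ≤ b → h s t = h s u + h u t)
    (hle : ∀ s t, a ≤ s → s ≤ t → t ≤ b → ‖h s t‖ ≤ ω s t ^ ζ + ω' s t ^ ζ) {s t : ℝ}
    (has : a ≤ s) (hst : s ≤ t) (htb : t ≤ b) : h s t = 0 := by
  have hsum : ∀ N n : ℕ, n ≤ N + 1 → h s (uniformPoint s t (N + 1) n) =
      ∑ i ∈ Finset.range n, h (uniformPoint s t (N + 1) i) (uniformPoint s t (N + 1) (i + 1)) := by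
    intro N n hn
    induction n with
    | zero =>
      have := hadd s s s has le_rfl le_rfl (hst.trans htb)
      simpa [uniformPoint_zero] using this
    | succ n ih =>
      rw [Finset.sum_range_succ, ← ih (by omega)]
      exact hadd _ _ _ has (left_le_uniformPoint hst _ _) (uniformPoint_mono hst _ n.le_succ)
        ((uniformPoint_le_right hst N.succ_ne_zero hn).trans htb)
  have hlim := ((hω.restrict has htb).tendsto_sum_rpow hst hζ).add
    ((hω'.restrict has htb).tendsto_sum_rpow hst hζ)
  rw [add_zero] at hlim
  refine norm_le_zero_iff.1 (ge_of_tendsto' hlim fun N => ?_)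
  have := hsum N (N + 1) le_rfl
  rw [uniformPoint_self s t N.succ_ne_zero] at this
  rw [this, ← Finset.sum_add_distrib]
  refine norm_sum_le_of_le _ fun i hi => ?_
  exact hle _ _ (has.trans (left_le_uniformPoint hst _ _)) (uniformPoint_mono hst _ i.le_succ)
    ((uniformPoint_le_right hst N.succ_ne_zero (Finset.mem_range.1 hi)).trans htb)

end Sewing

/-- **Sewing lemma** (Lemma 2.6 / `lemma-lambda`): for `ζ > 1` there is a universal
constant `C_ζ` such that for any interval `[a,b]`, any Banach space `E`, any
`G : {s ≤ u ≤ t} → E` lying in the image of `δ` and satisfying `‖G_{sut}‖ ≤ ω(s,t)^ζ`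
for a regular control `ω`, there is a unique `ΛG ∈ V^{1/ζ}_2([a,b];E)` with
`δ(ΛG) = G`, and it satisfies `‖(ΛG)_{st}‖ ≤ C_ζ ω(s,t)^ζ`. -/
theorem sewing_lemma (ζ : ℝ) (hζ : 1 < ζ) :
    ∃ C : ℝ, 0 < C ∧
      ∀ (E : Type) [NormedAddCommGroup E] [NormedSpace ℝ E] [CompleteSpace E],
      ∀ (a b : ℝ), a ≤ b →
      ∀ (G : ℝ → ℝ → ℝ → E) (B : ℝ → ℝ → E),
        (∀ s u t, a ≤ s → s ≤ u → u ≤ t → t ≤ b → G s u t = B s t - B s u - B u t) →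
      ∀ (ω : ℝ → ℝ → ℝ), IsRegularControl a b ω →
        (∀ s u t, a ≤ s → s ≤ u → u ≤ t → t ≤ b → ‖G s u t‖ ≤ ω s t ^ ζ) →
        (∃ Λ : ℝ → ℝ → E, MemVp2 (1 / ζ) a b Λ ∧
          (∀ s u t, a ≤ s → s ≤ u → u ≤ t → t ≤ b → Λ s t - Λ s u - Λ u t = G s u t) ∧
          (∀ s t, a ≤ s → s ≤ t → t ≤ b → ‖Λ s t‖ ≤ C * ω s t ^ ζ)) ∧
        (∀ Λ Λ' : ℝ → ℝ → E,
          MemVp2 (1 / ζ) a b Λ →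
          (∀ s u t, a ≤ s → s ≤ u → u ≤ t → t ≤ b → Λ s t - Λ s u - Λ u t = G s u t) →
          MemVp2 (1 / ζ) a b Λ' →
          (∀ s u t, a ≤ s → s ≤ u → u ≤ t → t ≤ b → Λ' s t - Λ' s u - Λ' u t = G s u t) →
          ∀ s t, a ≤ s → s ≤ t → t ≤ b → Λ s t = Λ' s t) := by
  refine ⟨sewingConst ζ, sewingConst_pos hζ, ?_⟩
  intro E _ _ _ a b hab G B hGB ω hω hG
  have hζ0 : 0 < ζ := by linarith
  have hB : ∀ s u t, a ≤ s → s ≤ u → u ≤ t → t ≤ b →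
      ‖B s t - B s u - B u t‖ ≤ ω s t ^ ζ := by
    intro s u t h1 h2 h3 h4
    rw [← hGB s u t h1 h2 h3 h4]
    exact hG s u t h1 h2 h3 h4
  have hself : ∀ s, a ≤ s → s ≤ b → B s s = 0 := fun s has hsb =>
    germ_self_eq_zero hζ hω.1 hB has hsb
  refine ⟨?_, ?_⟩
  · obtain ⟨y, hy⟩ := exists_path_norm_sub_le hζ hab hω hB
    refine ⟨fun s t => B s t - (y t - y s), ?_, ?_, hy⟩
    · refine memVp2_of_le hω (K := sewingConst ζ ^ (1 / ζ))
        (Real.rpow_nonneg (sewingConst_pos hζ).le _) fun s t has hst htb => ?_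
      have h0 := hω.1.1 s t has hst htb
      calc _ ≤ (sewingConst ζ * ω s t ^ ζ) ^ (1 / ζ) :=
            Real.rpow_le_rpow (norm_nonneg _) (hy s t has hst htb) (by positivity)
        _ = _ := by
            rw [Real.mul_rpow (sewingConst_pos hζ).le (Real.rpow_nonneg h0 _),
              one_div, Real.rpow_rpow_inv h0 hζ0.ne']
    · intro s u t h1 h2 h3 h4
      rw [hGB s u t h1 h2 h3 h4]
      dsimp only
      abel
  · intro Λ Λ' hΛ hδ hΛ' hδ' s t has hst htb
    have hdiag : ∀ Θ : ℝ → ℝ → E,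
        (∀ s u t, a ≤ s → s ≤ u → u ≤ t → t ≤ b → Θ s t - Θ s u - Θ u t = G s u t) →
        ∀ s, a ≤ s → s ≤ b → Θ s s = 0 := by
      intro Θ hΘ s has hsb
      have h := hΘ s s s has le_rfl le_rfl hsb
      rw [hGB s s s has le_rfl le_rfl hsb, hself s has hsb] at h
      simpa using h
    refine sub_eq_zero.1 (eq_zero_of_additive_of_norm_le (h := fun s t => Λ s t - Λ' s t) hζ
      hΛ.2 hΛ'.2 ?_ ?_ has hst htb)
    · intro s u t h1 h2 h3 h4
      have h := (hδ s u t h1 h2 h3 h4).trans (hδ' s u t h1 h2 h3 h4).symm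
      rw [← sub_eq_zero] at h ⊢
      rw [← h]
      abel
    · intro s t has hst htb
      exact norm_sub_le_of_le
        (hΛ.norm_le_pVarSum_rpow hζ has hst htb (hdiag Λ hδ s has (hst.trans htb)))
        (hΛ'.norm_le_pVarSum_rpow hζ has hst htb (hdiag Λ' hδ' s has (hst.trans htb)))

end
end

section
/- Let T > 0, 2 ≤ p < 3, a ≥ 0, f ∈ C²_b(ℝ; L(ℝ^N,ℝ)), and let x ∈ C¹([0,T];ℝ^N). Let ω be a regular control on [0,T] such that |δx_{st}| + |X²_{st}|^{1/2} ≤ ω(s,t)^{1/p} for all s ≤ t, where X^{2,ij}_{st} := ∫_s^t (x^i_u − x^i_s)(x^j)'(u) du. Let (y,m) be a solution of the reflected ODE driven by x with initial condition a. Then there exist constants ε₀ > 0 and C > 0 depending only on f and p such that for every interval I ⊂ [0,T] with ω(I) ≤ ε₀ and all s ≤ t in I, m_t − m_s ≤ C ω(s,t)^{1/p}. -/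
open MeasureTheory Set Filter

noncomputable section

/-- `f ∈ C^k_b(ℝ;ℝ)` : `k` times differentiable, bounded with bounded derivatives. -/
def CbOfDeg (k : ℕ) (f : ℝ → ℝ) : Prop :=
  ContDiff ℝ k f ∧ ∀ j ≤ k, ∃ C, ∀ x, |iteratedDeriv j f x| ≤ C

/-- The step-2 lift of a `C¹` path `x`:
`X²_{st}^{ij} = ∫_s^t (x^i_u - x^i_s) (x^j)'(u) du`. -/
def smoothLift {N : ℕ} (x : ℝ → Fin N → ℝ) : ℝ → ℝ → Fin N → Fin N → ℝ :=
  fun s t i j => ∫ u in s..t, (x u i - x s i) * deriv (fun v => x v j) u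

/-- `(y, m)` (with Stieltjes measure `μ` of `m`) solves the reflected ODE
`dy = f(y) dx + dm`, `y dm = 0` on `[0,T]`, driven by the `C¹` path `x`, with initial
condition `a`. -/
def SolvesReflectedODE (T : ℝ) {N : ℕ} (f : Fin N → ℝ → ℝ) (x : ℝ → Fin N → ℝ)
    (a : ℝ) (y m : ℝ → ℝ) (μ : MeasureTheory.Measure ℝ) : Prop :=
  ContinuousOn y (Set.Icc 0 T) ∧ (∀ t ∈ Set.Icc (0 : ℝ) T, 0 ≤ y t) ∧
  ContinuousOn m (Set.Icc 0 T) ∧ MonotoneOn m (Set.Icc (0 : ℝ) T) ∧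
  m 0 = 0 ∧ (∀ t ∈ Set.Icc (0 : ℝ) T, 0 ≤ m t) ∧
  y 0 = a ∧
  (∀ s t, 0 ≤ s → s ≤ t → t ≤ T →
    y t - y s = (∑ i, ∫ u in s..t, f i (y u) * deriv (fun v => x v i) u) + (m t - m s)) ∧
  (∀ s t, 0 ≤ s → s ≤ t → t ≤ T → μ (Set.Ioc s t) = ENNReal.ofReal (m t - m s)) ∧
  μ {u | u ∈ Set.Ioc (0 : ℝ) T ∧ y u ≠ 0} = 0

/-- Discrete sewing estimate: a two-parameter family vanishing on neighbouring indices, whose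
defect of additivity is bounded by a power `θ > 1` of a superadditive family `κ`, is itself bounded
by that power of `κ`. -/
theorem abs_le_of_abs_defect_le_of_succ_eq_zero {n : ℕ} {θ c L : ℝ} {h κ : ℕ → ℕ → ℝ}
    (hL : 0 ≤ L) (hθ : 0 < θ) (hc : 0 ≤ c)
    (hcθ : c * (2 : ℝ) ^ (1 - θ) + 2 ≤ c)
    (hκ : ∀ i j, i ≤ j → j ≤ n → 0 ≤ κ i j)
    (hκadd : ∀ i j k, i ≤ j → j ≤ k → k ≤ n → κ i j + κ j k ≤ κ i k)
    (hdef : ∀ i j k, i ≤ j → j ≤ k → k ≤ n → |h i k - h i j - h j k| ≤ L * κ i k ^ θ)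
    (hsucc : ∀ i, i + 1 ≤ n → h i (i + 1) = 0) :
    ∀ d i j, j = i + d → j ≤ n → |h i j| ≤ c * L * κ i j ^ θ := by
  have hκ0 : ∀ i, i ≤ n → κ i i = 0 := fun i hi => by
    have h1 := hκadd i i i le_rfl le_rfl hi
    have h2 := hκ i i le_rfl hi
    linarith
  intro d
  induction d using Nat.strong_induction_on with
  | _ d ih =>
  intro i j hj hjn
  rcases Nat.eq_zero_or_pos d with rfl | hd
  · obtain rfl : j = i := by omega
    have h1 := hdef j j j le_rfl le_rfl hjn
    rw [hκ0 j hjn, Real.zero_rpow hθ.ne'] at h1 ⊢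
    rw [show h j j - h j j - h j j = -h j j by ring, abs_neg] at h1
    linarith
  set P : ℕ → Prop := fun k => i ≤ k ∧ κ i k ≤ κ i j / 2 with hP
  classical
  have hij0 : 0 ≤ κ i j := hκ i j (by omega) hjn
  have hPi : P i := ⟨le_rfl, by rw [hκ0 i (by omega)]; linarith⟩
  set k := Nat.findGreatest P (j - 1) with hk
  have hPk : P k := Nat.findGreatest_spec (m := i) (by omega) hPi
  have hkj : k ≤ j - 1 := Nat.findGreatest_le _
  have hright : κ (k + 1) j ≤ κ i j / 2 := by
    rcases Nat.lt_or_ge (k + 1) j with hlt | hge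
    · have hnot : ¬ P (k + 1) := Nat.findGreatest_is_greatest (n := j - 1) (by omega) (by omega)
      have h1 : κ i j / 2 < κ i (k + 1) := by
        by_contra hcon
        exact hnot ⟨by have := hPk.1; omega, not_lt.mp hcon⟩
      have h2 := hκadd i (k + 1) j (by have := hPk.1; omega) (by omega) hjn
      linarith
    · obtain hkj' : k + 1 = j := by omega
      rw [hkj', hκ0 j hjn]; linarith
  have hik := hPk.1
  have e1 := ih (k - i) (by omega) i k (by omega) (by omega)
  have e2 := ih (j - (k + 1)) (by omega) (k + 1) j (by omega) hjn
  have e3 := hdef i k j hik (by omega) hjn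
  have e4 := hdef k (k + 1) j (by omega) (by omega) hjn
  rw [hsucc k (by omega)] at e4
  have hmono : ∀ r, 0 ≤ r → r ≤ κ i j / 2 → r ^ θ ≤ (2 : ℝ) ^ (-θ) * κ i j ^ θ := by
    intro r hr hr2
    calc r ^ θ ≤ (κ i j / 2) ^ θ := Real.rpow_le_rpow hr hr2 hθ.le
      _ = (2 : ℝ) ^ (-θ) * κ i j ^ θ := by
        rw [Real.div_rpow hij0 (by norm_num), Real.rpow_neg (by norm_num)]
        field_simp
  have m1 := hmono _ (hκ i k hik (by omega)) hPk.2
  have m2 := hmono _ (hκ (k + 1) j (by omega) hjn) hright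
  have m3 : κ k j ^ θ ≤ κ i j ^ θ := by
    refine Real.rpow_le_rpow (hκ k j (by omega) hjn) ?_ hθ.le
    have := hκadd i k j hik (by omega) hjn
    have := hκ i k hik (by omega)
    linarith
  have h2 : (2 : ℝ) ^ (1 - θ) = 2 * (2 : ℝ) ^ (-θ) := by
    rw [show 1 - θ = 1 + -θ by ring, Real.rpow_add (by norm_num), Real.rpow_one]
  have htri : |h i j| ≤ |h i j - h i k - h k j| + |h i k| + |h k j - 0 - h (k + 1) j|
      + |h (k + 1) j| := by
    have : h i j = (h i j - h i k - h k j) + h i k + (h k j - 0 - h (k + 1) j) + h (k + 1) j := by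
      ring
    conv_lhs => rw [this]
    refine (abs_add_le _ _).trans (add_le_add_left ((abs_add_le _ _).trans
      (add_le_add_left (abs_add_le _ _) _)) _)
  have hcL : 0 ≤ c * L := mul_nonneg hc hL
  have m1' := mul_le_mul_of_nonneg_left m1 hcL
  have m2' := mul_le_mul_of_nonneg_left m2 hcL
  have m3' := mul_le_mul_of_nonneg_left m3 hL
  have hfin := mul_le_mul_of_nonneg_right hcθ (mul_nonneg hL (Real.rpow_nonneg hij0 θ))
  rw [h2] at hfin
  nlinarith [hfin]

/-- Sewing estimate for a two-parameter family that is negligible on fine partitions. -/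
theorem abs_le_of_abs_defect_le {a b θ c L M : ℝ} {h κ : ℝ → ℝ → ℝ} {ν : ℝ → ℝ}
    (hL : 0 ≤ L) (hθ : 0 < θ) (hc : 0 ≤ c)
    (hcθ : c * (2 : ℝ) ^ (1 - θ) + 2 ≤ c)
    (hκ : IsControl a b κ)
    (hdef : ∀ s u t, a ≤ s → s ≤ u → u ≤ t → t ≤ b →
      |h s t - h s u - h u t| ≤ L * κ s t ^ θ)
    (hsmall : ∀ s t, a ≤ s → s ≤ t → t ≤ b → |h s t| ≤ M * (t - s) * (ν t - ν s))
    {s t : ℝ} (has : a ≤ s) (hst : s ≤ t) (htb : t ≤ b) :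
    |h s t| ≤ c * L * κ s t ^ θ := by
  have key : ∀ n : ℕ, |h s t| ≤ c * L * κ s t ^ θ + M * (t - s) * (ν t - ν s) / ((n : ℝ) + 1) := by
    intro n
    set u : ℕ → ℝ := fun l => s + l * ((t - s) / ((n : ℝ) + 1)) with hu
    have hn : (0 : ℝ) < (n : ℝ) + 1 := by positivity
    have hstep : 0 ≤ (t - s) / ((n : ℝ) + 1) := div_nonneg (by linarith) hn.le
    have hu0 : u 0 = s := by simp [hu]
    have hun : u (n + 1) = t := by simp only [hu]; push_cast; field_simp; ring
    have humono : ∀ i j, i ≤ j → u i ≤ u j := fun i j hij => by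
      simp only [hu]; gcongr
    have hua : ∀ i, a ≤ u i := fun i => by
      have := humono 0 i (Nat.zero_le _); linarith
    have hub : ∀ i, i ≤ n + 1 → u i ≤ b := fun i hi => by
      have := humono i (n + 1) hi; linarith
    set S : ℕ → ℝ := fun j => ∑ l ∈ Finset.range j, h (u l) (u (l + 1)) with hS
    have main := abs_le_of_abs_defect_le_of_succ_eq_zero (n := n + 1)
      (h := fun i j => h (u i) (u j) - (S j - S i)) (κ := fun i j => κ (u i) (u j)) hL hθ hc hcθ
      (fun i j hij hj => hκ.1 _ _ (hua i) (humono i j hij) (hub j hj))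
      (fun i j k hij hjk hk => hκ.2 _ _ _ (hua i) (humono i j hij) (humono j k hjk) (hub k hk))
      (fun i j k hij hjk hk => by
        have := hdef _ _ _ (hua i) (humono i j hij) (humono j k hjk) (hub k hk)
        convert this using 2
        ring)
      (fun i _ => by simp [hS, Finset.sum_range_succ])
      (n + 1) 0 (n + 1) (by omega) le_rfl
    simp only [hu0, hun] at main
    have hSbound : |S (n + 1) - S 0| ≤ M * (t - s) * (ν t - ν s) / ((n : ℝ) + 1) := by
      have h0 : S 0 = 0 := by simp [hS]
      rw [h0, sub_zero]
      calc |S (n + 1)| ≤ ∑ l ∈ Finset.range (n + 1), |h (u l) (u (l + 1))| :=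
            Finset.abs_sum_le_sum_abs _ _
        _ ≤ ∑ l ∈ Finset.range (n + 1), M * ((t - s) / ((n : ℝ) + 1)) * (ν (u (l + 1)) - ν (u l)) := by
            refine Finset.sum_le_sum fun l hl => ?_
            have hl' := Finset.mem_range.mp hl
            have := hsmall _ _ (hua l) (humono l (l + 1) (by omega)) (hub (l + 1) (by omega))
            rwa [show u (l + 1) - u l = (t - s) / ((n : ℝ) + 1) by
              simp only [hu]; push_cast; ring] at this
        _ = M * (t - s) * (ν t - ν s) / ((n : ℝ) + 1) := by
            rw [← Finset.mul_sum, Finset.sum_range_sub (fun l => ν (u l)), hu0, hun]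
            ring
    have : |h s t| ≤ |h s t - (S (n + 1) - S 0)| + |S (n + 1) - S 0| := by
      simpa using abs_add_le (h s t - (S (n + 1) - S 0)) (S (n + 1) - S 0)
    exact this.trans (add_le_add main hSbound)
  have hlim : Tendsto (fun n : ℕ => c * L * κ s t ^ θ + M * (t - s) * (ν t - ν s) / ((n : ℝ) + 1))
      atTop (nhds (c * L * κ s t ^ θ + 0)) := by
    refine tendsto_const_nhds.add (Tendsto.div_atTop tendsto_const_nhds ?_)
    exact tendsto_atTop_add_const_right _ _ tendsto_natCast_atTop_atTop
  rw [add_zero] at hlim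
  exact ge_of_tendsto' hlim key

/-- Superadditivity of `(a, b) ↦ a ^ α * b ^ β` for `α + β ≥ 1`, a reverse Hölder inequality. -/
theorem rpow_mul_rpow_add_le {α β a₁ a₂ b₁ b₂ : ℝ} (hα : 0 < α) (hβ : 0 < β) (hβ1 : β ≤ 1)
    (hαβ : 1 ≤ α + β) (ha₁ : 0 ≤ a₁) (ha₂ : 0 ≤ a₂) (hb₁ : 0 ≤ b₁) (hb₂ : 0 ≤ b₂) :
    a₁ ^ α * b₁ ^ β + a₂ ^ α * b₂ ^ β ≤ (a₁ + a₂) ^ α * (b₁ + b₂) ^ β := by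
  rcases (add_nonneg ha₁ ha₂).eq_or_lt with ha | ha
  · obtain rfl : a₁ = 0 := by linarith
    obtain rfl : a₂ = 0 := by linarith
    simp [Real.zero_rpow hα.ne']
  rcases (add_nonneg hb₁ hb₂).eq_or_lt with hb | hb
  · obtain rfl : b₁ = 0 := by linarith
    obtain rfl : b₂ = 0 := by linarith
    simp [Real.zero_rpow hβ.ne']
  have hterm : ∀ a' b', 0 ≤ a' → a' ≤ a₁ + a₂ → 0 ≤ b' → a' ^ α * b' ^ β ≤
      ((1 - β) * (a' / (a₁ + a₂)) + β * (b' / (b₁ + b₂))) *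
        ((a₁ + a₂) ^ α * (b₁ + b₂) ^ β) := by
    intro a' b' ha' ha'' hb'
    have hr : 0 ≤ a' / (a₁ + a₂) := div_nonneg ha' ha.le
    have hr1 : a' / (a₁ + a₂) ≤ 1 := (div_le_one ha).mpr ha''
    have hq : 0 ≤ b' / (b₁ + b₂) := div_nonneg hb' hb.le
    have h1 : (a' / (a₁ + a₂)) ^ α ≤ (a' / (a₁ + a₂)) ^ (1 - β) := by
      rcases hr.eq_or_lt with h0 | h0
      · rw [← h0, Real.zero_rpow hα.ne']
        exact Real.rpow_nonneg le_rfl _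
      · exact Real.rpow_le_rpow_of_exponent_ge h0 hr1 (by linarith)
    have h2 := Real.geom_mean_le_arith_mean2_weighted (by linarith : 0 ≤ 1 - β) hβ.le hr hq
      (by ring)
    have h3 : (a' / (a₁ + a₂)) ^ α * (b' / (b₁ + b₂)) ^ β ≤
        (1 - β) * (a' / (a₁ + a₂)) + β * (b' / (b₁ + b₂)) :=
      (mul_le_mul_of_nonneg_right h1 (Real.rpow_nonneg hq _)).trans h2
    have h4 := mul_le_mul_of_nonneg_right h3
      (by positivity : 0 ≤ (a₁ + a₂) ^ α * (b₁ + b₂) ^ β)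
    refine le_trans (le_of_eq ?_) h4
    rw [Real.div_rpow ha' ha.le, Real.div_rpow hb' hb.le]
    have := (Real.rpow_pos_of_pos ha α).ne'
    have := (Real.rpow_pos_of_pos hb β).ne'
    field_simp
  have e1 := hterm a₁ b₁ ha₁ (by linarith) hb₁
  have e2 := hterm a₂ b₂ ha₂ (by linarith) hb₂
  refine (add_le_add e1 e2).trans (le_of_eq ?_)
  rw [← add_mul]
  have : (1 - β) * (a₁ / (a₁ + a₂)) + β * (b₁ / (b₁ + b₂)) +
      ((1 - β) * (a₂ / (a₁ + a₂)) + β * (b₂ / (b₁ + b₂))) = 1 := by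
    field_simp
    ring
  rw [this, one_mul]

theorem IsControl.mono {a b : ℝ} {ω : ℝ → ℝ → ℝ} (hω : IsControl a b ω) {s s' t' t : ℝ}
    (has : a ≤ s) (hs : s ≤ s') (hst : s' ≤ t') (ht : t' ≤ t) (htb : t ≤ b) :
    ω s' t' ≤ ω s t := by
  have h1 := hω.2 s s' t has hs (hst.trans ht) htb
  have h2 := hω.2 s' t' t (has.trans hs) hst ht htb
  have h3 := hω.1 s s' has hs (hst.trans (ht.trans htb))
  have h4 := hω.1 t' t (has.trans (hs.trans hst)) ht htb
  linarith

/-- Young-type control combining a control with the increments of a monotone path. -/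
theorem isControl_add_rpow_mul_rpow {a b p : ℝ} (hp2 : 2 ≤ p) {ω : ℝ → ℝ → ℝ} {m : ℝ → ℝ}
    (hω : IsControl a b ω) (hm : MonotoneOn m (Icc a b)) :
    IsControl a b (fun s t => ω s t + (m t - m s) ^ (p / 3) * ω s t ^ ((1 : ℝ) / 3)) := by
  have hm' : ∀ s t, a ≤ s → s ≤ t → t ≤ b → 0 ≤ m t - m s := fun s t h1 h2 h3 =>
    sub_nonneg.mpr (hm ⟨h1, h2.trans h3⟩ ⟨h1.trans h2, h3⟩ h2)
  refine ⟨fun s t h1 h2 h3 => ?_, fun s u t h1 h2 h3 h4 => ?_⟩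
  · have := hω.1 s t h1 h2 h3
    have := hm' s t h1 h2 h3
    positivity
  · have c1 := hω.1 s u h1 h2 (h3.trans h4)
    have c2 := hω.1 u t (h1.trans h2) h3 h4
    have c3 := hω.2 s u t h1 h2 h3 h4
    have d1 := hm' s u h1 h2 (h3.trans h4)
    have d2 := hm' u t (h1.trans h2) h3 h4
    have e := rpow_mul_rpow_add_le (α := p / 3) (β := 1 / 3) (by linarith) (by norm_num)
      (by norm_num) (by linarith) d1 d2 c1 c2
    have e' : (m u - m s + (m t - m u)) ^ (p / 3) * (ω s u + ω u t) ^ ((1 : ℝ) / 3) ≤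
        (m t - m s) ^ (p / 3) * ω s t ^ ((1 : ℝ) / 3) := by
      rw [show m u - m s + (m t - m u) = m t - m s by ring]
      exact mul_le_mul_of_nonneg_left (Real.rpow_le_rpow (by linarith) c3 (by norm_num))
        (Real.rpow_nonneg (by linarith) _)
    dsimp only
    linarith

/-- A priori estimate for a remainder whose defect of additivity is controlled in terms of the
remainder itself, for a control dominating a multiple of the length. -/
theorem abs_remainder_le_of_length_le {p a b c K M δ : ℝ} (hp2 : 2 ≤ p)
    {ω h : ℝ → ℝ → ℝ} {m : ℝ → ℝ} (hc : 0 ≤ c) (hK : 0 ≤ K)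
    (hKp : K * (2 : ℝ) ^ (1 - 3 / p) + 2 ≤ K)
    (hω : IsControl a b ω) (hm : MonotoneOn m (Icc a b))
    (hdef : ∀ s u t, a ≤ s → s ≤ u → u ≤ t → t ≤ b → |h s t - h s u - h u t| ≤
      c * (ω s t ^ (3 / p) + (m u - m s + |h s u|) * ω s t ^ (1 / p)))
    (hM : 0 ≤ M)
    (hsmall : ∀ s t, a ≤ s → s ≤ t → t ≤ b → |h s t| ≤ M * (t - s) * ((t - s) + (m t - m s)))
    (hδ : 0 < δ) (hδω : ∀ s t, a ≤ s → s ≤ t → t ≤ b → δ * (t - s) ≤ ω s t)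
    (hab : a ≤ b) (hω1 : ω a b ≤ 1) (hωK : K * c * ω a b ^ (1 / p) ≤ 1 / 2)
    {s t : ℝ} (has : a ≤ s) (hst : s ≤ t) (htb : t ≤ b) :
    |h s t| ≤ 16 * K * c * (ω s t ^ (3 / p) + (m t - m s) * ω s t ^ (1 / p)) := by
  have hp0 : 0 < p := by linarith
  have hm' : ∀ s t, a ≤ s → s ≤ t → t ≤ b → 0 ≤ m t - m s := fun s t h1 h2 h3 =>
    sub_nonneg.mpr (hm ⟨h1, h2.trans h3⟩ ⟨h1.trans h2, h3⟩ h2)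
  have hθ0 : 0 < 3 / p := by positivity
  have h1p : 0 ≤ 1 / p := by positivity
  set κ : ℝ → ℝ → ℝ := fun s t => ω s t + (m t - m s) ^ (p / 3) * ω s t ^ ((1 : ℝ) / 3) with hκdef
  have hκ : IsControl a b κ := isControl_add_rpow_mul_rpow hp2 hω hm
  have hprod : ∀ s t, a ≤ s → s ≤ t → t ≤ b →
      ((m t - m s) ^ (p / 3) * ω s t ^ ((1 : ℝ) / 3)) ^ (3 / p) = (m t - m s) * ω s t ^ (1 / p) := by
    intro s t h1 h2 h3
    have w0 := hω.1 s t h1 h2 h3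
    have d0 := hm' s t h1 h2 h3
    rw [Real.mul_rpow (by positivity) (by positivity), ← Real.rpow_mul d0, ← Real.rpow_mul w0]
    rw [show p / 3 * (3 / p) = 1 by field_simp, show (1 : ℝ) / 3 * (3 / p) = 1 / p by field_simp,
      Real.rpow_one]
  have hκ1 : ∀ s t, a ≤ s → s ≤ t → t ≤ b → ω s t ^ (3 / p) ≤ κ s t ^ (3 / p) := by
    intro s t h1 h2 h3
    have w0 := hω.1 s t h1 h2 h3
    have d0 := hm' s t h1 h2 h3
    refine Real.rpow_le_rpow w0 ?_ hθ0.le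
    simp only [hκdef]
    have : 0 ≤ (m t - m s) ^ (p / 3) * ω s t ^ ((1 : ℝ) / 3) := by positivity
    linarith
  have hκ2 : ∀ s t, a ≤ s → s ≤ t → t ≤ b → (m t - m s) * ω s t ^ (1 / p) ≤ κ s t ^ (3 / p) := by
    intro s t h1 h2 h3
    have w0 := hω.1 s t h1 h2 h3
    have d0 := hm' s t h1 h2 h3
    rw [← hprod s t h1 h2 h3]
    refine Real.rpow_le_rpow (by positivity) ?_ hθ0.le
    simp only [hκdef]
    linarith
  have hκ3 : ∀ s t, a ≤ s → s ≤ t → t ≤ b →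
      κ s t ^ (3 / p) ≤ 4 * (ω s t ^ (3 / p) + (m t - m s) * ω s t ^ (1 / p)) := by
    intro s t h1 h2 h3
    have w0 := hω.1 s t h1 h2 h3
    have d0 := hm' s t h1 h2 h3
    have z0 : 0 ≤ (m t - m s) ^ (p / 3) * ω s t ^ ((1 : ℝ) / 3) := by positivity
    have two : (2 : ℝ) ^ (3 / p) ≤ 4 := by
      calc (2 : ℝ) ^ (3 / p) ≤ (2 : ℝ) ^ (2 : ℝ) := by
            refine Real.rpow_le_rpow_of_exponent_le (by norm_num) ?_
            rw [div_le_iff₀ hp0]; linarith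
        _ = 4 := by norm_num
    have w1 : 0 ≤ ω s t ^ (3 / p) := by positivity
    have w2 : 0 ≤ (m t - m s) * ω s t ^ (1 / p) := by positivity
    rcases le_total (ω s t) ((m t - m s) ^ (p / 3) * ω s t ^ ((1 : ℝ) / 3)) with hle | hle
    · calc κ s t ^ (3 / p) ≤ (2 * ((m t - m s) ^ (p / 3) * ω s t ^ ((1 : ℝ) / 3))) ^ (3 / p) := by
            refine Real.rpow_le_rpow (hκ.1 s t h1 h2 h3) ?_ hθ0.le
            simp only [hκdef]; linarith
        _ = 2 ^ (3 / p) * ((m t - m s) * ω s t ^ (1 / p)) := by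
            rw [Real.mul_rpow (by norm_num) z0, hprod s t h1 h2 h3]
        _ ≤ 4 * ((m t - m s) * ω s t ^ (1 / p)) := mul_le_mul_of_nonneg_right two w2
        _ ≤ _ := by linarith
    · calc κ s t ^ (3 / p) ≤ (2 * ω s t) ^ (3 / p) := by
            refine Real.rpow_le_rpow (hκ.1 s t h1 h2 h3) ?_ hθ0.le
            simp only [hκdef]; linarith
        _ = 2 ^ (3 / p) * ω s t ^ (3 / p) := Real.mul_rpow (by norm_num) w0
        _ ≤ 4 * ω s t ^ (3 / p) := mul_le_mul_of_nonneg_right two w1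
        _ ≤ _ := by linarith
  have base : ∀ s t, a ≤ s → s ≤ t → t ≤ b → |h s t| ≤ (M / δ ^ 2 + M / δ) * κ s t ^ (3 / p) := by
    intro s t h1 h2 h3
    have d0 := hm' s t h1 h2 h3
    have w0 := hω.1 s t h1 h2 h3
    set r := δ * (t - s) with hr
    have r0 : 0 ≤ r := mul_nonneg hδ.le (by linarith)
    have rω : r ≤ ω s t := hδω s t h1 h2 h3
    have r1 : r ≤ 1 := rω.trans ((hω.mono le_rfl h1 h2 h3 le_rfl).trans hω1)
    have hpow : ∀ q : ℝ, 0 < q → ∀ k : ℕ, k ≠ 0 → q ≤ k → r ^ k ≤ ω s t ^ q := by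
      intro q hq k hk hqk
      rw [← Real.rpow_natCast]
      refine le_trans ?_ (Real.rpow_le_rpow r0 rω hq.le)
      rcases r0.eq_or_lt with h0 | h0
      · rw [← h0, Real.zero_rpow hq.ne', Real.zero_rpow (by exact_mod_cast hk)]
      · exact Real.rpow_le_rpow_of_exponent_ge h0 r1 hqk
    have q1 := (hpow (3 / p) hθ0 2 (by norm_num) (by
      rw [div_le_iff₀ hp0]; push_cast; linarith)).trans (hκ1 s t h1 h2 h3)
    have q2 := hpow (1 / p) (by positivity) 1 (by norm_num) (by
      rw [div_le_iff₀ hp0]; push_cast; linarith)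
    rw [pow_one] at q2
    have q3 := (mul_le_mul_of_nonneg_left q2 d0).trans (hκ2 s t h1 h2 h3)
    calc |h s t| ≤ M * (t - s) * ((t - s) + (m t - m s)) := hsmall s t h1 h2 h3
      _ = M / δ ^ 2 * r ^ 2 + M / δ * ((m t - m s) * r) := by rw [hr]; field_simp
      _ ≤ M / δ ^ 2 * κ s t ^ (3 / p) + M / δ * κ s t ^ (3 / p) := by gcongr
      _ = _ := by ring
  have step : ∀ K', 0 ≤ K' → (∀ s t, a ≤ s → s ≤ t → t ≤ b → |h s t| ≤ K' * κ s t ^ (3 / p)) →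
      ∀ s t, a ≤ s → s ≤ t → t ≤ b → |h s t| ≤ (2 * K * c + K' / 2) * κ s t ^ (3 / p) := by
    intro K' hK' hP s t h1 h2 h3
    have e0 : 0 ≤ ω a b ^ (1 / p) := Real.rpow_nonneg (hω.1 a b le_rfl hab le_rfl) _
    have := abs_le_of_abs_defect_le (a := a) (b := b) (L := 2 * c + c * K' * ω a b ^ (1 / p))
      (θ := 3 / p) (M := M) (ν := fun t => t + m t) (h := h) (κ := κ) (c := K)
      (by positivity) hθ0 hK hKp hκ
      (by
        intro s u t h1 h2 h3 h4
        have k1 := hκ1 s t h1 (h2.trans h3) h4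
        have k2 := hκ2 s t h1 (h2.trans h3) h4
        have w0 := hω.1 s t h1 (h2.trans h3) h4
        have k3 := hP s u h1 h2 (h3.trans h4)
        have k4 : κ s u ^ (3 / p) ≤ κ s t ^ (3 / p) :=
          Real.rpow_le_rpow (hκ.1 s u h1 h2 (h3.trans h4)) (hκ.mono h1 le_rfl h2 h3 h4) hθ0.le
        have k5 : ω s t ^ (1 / p) ≤ ω a b ^ (1 / p) :=
          Real.rpow_le_rpow w0 (hω.mono le_rfl h1 (h2.trans h3) h4 le_rfl) h1p
        have k6 : (m u - m s) * ω s t ^ (1 / p) ≤ (m t - m s) * ω s t ^ (1 / p) := by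
          have := hm' u t (h1.trans h2) h3 h4
          refine mul_le_mul_of_nonneg_right (by linarith) (by positivity)
        have k7 : |h s u| * ω s t ^ (1 / p) ≤ K' * κ s t ^ (3 / p) * ω a b ^ (1 / p) :=
          mul_le_mul (k3.trans (mul_le_mul_of_nonneg_left k4 hK')) k5 (by positivity)
            (mul_nonneg hK' (Real.rpow_nonneg (hκ.1 s t h1 (h2.trans h3) h4) _))
        refine (hdef s u t h1 h2 h3 h4).trans ?_
        calc c * (ω s t ^ (3 / p) + (m u - m s + |h s u|) * ω s t ^ (1 / p))
            ≤ c * (κ s t ^ (3 / p) + κ s t ^ (3 / p) + K' * κ s t ^ (3 / p) * ω a b ^ (1 / p)) := by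
              refine mul_le_mul_of_nonneg_left ?_ hc
              rw [add_mul]; linarith
          _ = _ := by ring)
      (by
        intro s t h1 h2 h3
        refine (hsmall s t h1 h2 h3).trans (le_of_eq ?_)
        ring)
      h1 h2 h3
    refine this.trans (mul_le_mul_of_nonneg_right ?_ (Real.rpow_nonneg (hκ.1 s t h1 h2 h3) _))
    have := mul_le_mul_of_nonneg_left hωK hK'
    linarith
  have iter : ∀ n : ℕ, ∀ s t, a ≤ s → s ≤ t → t ≤ b →
      |h s t| ≤ (4 * K * c + (M / δ ^ 2 + M / δ) / 2 ^ n) * κ s t ^ (3 / p) := by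
    intro n
    induction n with
    | zero =>
      intro s t h1 h2 h3
      refine (base s t h1 h2 h3).trans
        (mul_le_mul_of_nonneg_right ?_ (Real.rpow_nonneg (hκ.1 s t h1 h2 h3) _))
      have : 0 ≤ 4 * K * c := by positivity
      simp only [pow_zero, div_one]
      linarith
    | succ n ih =>
      intro s t h1 h2 h3
      refine (step _ (by positivity) ih s t h1 h2 h3).trans (le_of_eq ?_)
      rw [pow_succ]
      field_simp
      ring
  have hlim : Tendsto (fun n : ℕ => (4 * K * c + (M / δ ^ 2 + M / δ) / 2 ^ n) * κ s t ^ (3 / p))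
      atTop (nhds ((4 * K * c + 0) * κ s t ^ (3 / p))) := by
    refine (tendsto_const_nhds.add (Tendsto.div_atTop tendsto_const_nhds ?_)).mul_const _
    exact tendsto_pow_atTop_atTop_of_one_lt (by norm_num)
  have hfin := ge_of_tendsto' hlim fun n => iter n s t has hst htb
  refine hfin.trans ?_
  have := mul_le_mul_of_nonneg_left (hκ3 s t has hst htb) (by positivity : 0 ≤ 4 * K * c)
  linarith

/-- A priori estimate for a remainder whose defect of additivity is controlled in terms of the
remainder itself. -/
theorem abs_remainder_le {p a b c K M : ℝ} (hp2 : 2 ≤ p)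
    {ω h : ℝ → ℝ → ℝ} {m : ℝ → ℝ} (hc : 0 ≤ c) (hK : 0 ≤ K)
    (hKp : K * (2 : ℝ) ^ (1 - 3 / p) + 2 ≤ K)
    (hω : IsControl a b ω) (hm : MonotoneOn m (Icc a b))
    (hdef : ∀ s u t, a ≤ s → s ≤ u → u ≤ t → t ≤ b → |h s t - h s u - h u t| ≤
      c * (ω s t ^ (3 / p) + (m u - m s + |h s u|) * ω s t ^ (1 / p)))
    (hM : 0 ≤ M)
    (hsmall : ∀ s t, a ≤ s → s ≤ t → t ≤ b → |h s t| ≤ M * (t - s) * ((t - s) + (m t - m s)))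
    (hab : a ≤ b) {ε : ℝ} (hωε : ω a b < ε) (hε1 : ε ≤ 1) (hεK : K * c * ε ^ (1 / p) ≤ 1 / 2)
    {s t : ℝ} (has : a ≤ s) (hst : s ≤ t) (htb : t ≤ b) :
    |h s t| ≤ 16 * K * c * (ω s t ^ (3 / p) + (m t - m s) * ω s t ^ (1 / p)) := by
  have hp0 : 0 < p := by linarith
  have h1p : 0 ≤ 1 / p := by positivity
  have h3p : 0 ≤ 3 / p := by positivity
  have hm' : ∀ s t, a ≤ s → s ≤ t → t ≤ b → 0 ≤ m t - m s := fun s t h1 h2 h3 =>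
    sub_nonneg.mpr (hm ⟨h1, h2.trans h3⟩ ⟨h1.trans h2, h3⟩ h2)
  have hcont : Continuous fun δ : ℝ => 16 * K * c * ((ω s t + δ * (t - s)) ^ (3 / p) +
      (m t - m s) * (ω s t + δ * (t - s)) ^ (1 / p)) := by
    have hl : Continuous fun δ : ℝ => ω s t + δ * (t - s) := by fun_prop
    exact continuous_const.mul ((hl.rpow_const fun _ => Or.inr h3p).add
      (continuous_const.mul (hl.rpow_const fun _ => Or.inr h1p)))
  have hlim := (hcont.tendsto 0).mono_left (nhdsWithin_le_nhds (s := Ioi 0))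
  simp only [zero_mul, add_zero] at hlim
  refine ge_of_tendsto hlim ?_
  have hsm : ∀ᶠ δ : ℝ in nhdsWithin 0 (Ioi 0), ω a b + δ * (b - a) < ε := by
    have hl : Continuous fun δ : ℝ => ω a b + δ * (b - a) := by fun_prop
    have := (hl.tendsto 0).mono_left (nhdsWithin_le_nhds (s := Ioi 0))
    simp only [zero_mul, add_zero] at this
    exact this.eventually_lt_const hωε
  filter_upwards [hsm, self_mem_nhdsWithin] with δ hδε hδ
  have hδ : 0 < δ := hδ
  have hωδ0 : 0 ≤ ω a b + δ * (b - a) :=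
    add_nonneg (hω.1 a b le_rfl hab le_rfl) (mul_nonneg hδ.le (by linarith))
  refine abs_remainder_le_of_length_le (ω := fun s t => ω s t + δ * (t - s)) hp2 hc hK hKp
    ⟨fun s t h1 h2 h3 => ?_, fun s u t h1 h2 h3 h4 => ?_⟩ hm (fun s u t h1 h2 h3 h4 => ?_) hM hsmall
    hδ (fun s t h1 h2 h3 => ?_) hab (hδε.le.trans hε1) ?_ has hst htb
  · exact add_nonneg (hω.1 s t h1 h2 h3) (mul_nonneg hδ.le (by linarith))
  · have := hω.2 s u t h1 h2 h3 h4
    dsimp only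
    linarith
  · refine (hdef s u t h1 h2 h3 h4).trans ?_
    have w0 := hω.1 s t h1 (h2.trans h3) h4
    have l0 : ω s t ≤ ω s t + δ * (t - s) := by
      have : 0 ≤ δ * (t - s) := mul_nonneg hδ.le (by linarith)
      linarith
    have d0 := hm' s u h1 h2 (h3.trans h4)
    gcongr
  · have := hω.1 s t h1 h2 h3
    linarith
  · refine le_trans ?_ hεK
    gcongr

/-- Uniform bounds of a `C²_b` function: value, derivative, Lipschitz and second-order Taylor. -/
structure SecondOrderBounds (B : ℝ) (g : ℝ → ℝ) : Prop where
  value : ∀ z, |g z| ≤ B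
  deriv_le : ∀ z, |deriv g z| ≤ B
  lipschitz : ∀ z w, |g w - g z| ≤ B * |w - z|
  deriv_lipschitz : ∀ z w, |deriv g w - deriv g z| ≤ B * |w - z|
  taylor : ∀ z r, |g (z + r) - g z - deriv g z * r| ≤ B * r ^ 2

theorem CbOfDeg.exists_secondOrderBounds {g : ℝ → ℝ} (hg : CbOfDeg 2 g) :
    ∃ B, ∀ B' ≥ B, SecondOrderBounds B' g := by
  obtain ⟨hg2, hb⟩ := hg
  obtain ⟨B0, h0⟩ := hb 0 (by norm_num)
  obtain ⟨B1, h1⟩ := hb 1 (by norm_num)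
  obtain ⟨B2, h2⟩ := hb 2 (by norm_num)
  simp only [iteratedDeriv_zero] at h0
  simp only [iteratedDeriv_one] at h1
  have hd : Differentiable ℝ g := hg2.differentiable (by norm_num)
  have hd1 : Differentiable ℝ (deriv g) := by
    have h := hg2.differentiable_iteratedDeriv 1 (by norm_num)
    simpa only [iteratedDeriv_one] using h
  have h2' : ∀ z, |deriv (deriv g) z| ≤ B2 := fun z => by
    have := h2 z
    rwa [iteratedDeriv_succ, iteratedDeriv_one] at this
  refine ⟨max B0 (max B1 B2), fun B hB => ?_⟩
  have hB0 : B0 ≤ B := (le_max_left _ _).trans hB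
  have hB1 : B1 ≤ B := (le_max_left _ _).trans ((le_max_right _ _).trans hB)
  have hB2 : B2 ≤ B := (le_max_right _ _).trans ((le_max_right _ _).trans hB)
  have hlip' : ∀ z w, |deriv g w - deriv g z| ≤ B * |w - z| := fun z w =>
    Convex.norm_image_sub_le_of_norm_deriv_le (fun v _ => hd1 v)
      (fun v _ => (h2' v).trans hB2) convex_univ (mem_univ z) (mem_univ w)
  refine ⟨fun z => (h0 z).trans hB0, fun z => (h1 z).trans hB1, fun z w => ?_, hlip', fun z r => ?_⟩
  · exact Convex.norm_image_sub_le_of_norm_deriv_le (fun v _ => hd v)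
      (fun v _ => (h1 v).trans hB1) convex_univ (mem_univ z) (mem_univ w)
  · have hBnn : 0 ≤ B := (abs_nonneg _).trans ((h0 z).trans hB0)
    have key := Convex.norm_image_sub_le_of_norm_hasDerivWithin_le
      (f := fun v => g v - deriv g z * v) (f' := fun v => deriv g v - deriv g z)
      (C := B * |r|) (s := uIcc z (z + r)) (x := z) (y := z + r)
      (fun v _ => by
        have := ((hd v).hasDerivAt.fun_sub ((hasDerivAt_id' v).const_mul (deriv g z)))
        rw [mul_one] at this
        exact this.hasDerivWithinAt)
      (fun v hv => by
        refine (hlip' z v).trans (mul_le_mul_of_nonneg_left ?_ hBnn)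
        have := abs_sub_left_of_mem_uIcc hv
        simpa using this)
      (convex_uIcc _ _) left_mem_uIcc right_mem_uIcc
    rw [Real.norm_eq_abs, Real.norm_eq_abs] at key
    have e1 : g (z + r) - deriv g z * (z + r) - (g z - deriv g z * z) =
        g (z + r) - g z - deriv g z * r := by ring
    rw [e1, add_sub_cancel_left, mul_assoc, abs_mul_abs_self] at key
    rwa [pow_two]

theorem exists_forall_secondOrderBounds {N : ℕ} {f : Fin N → ℝ → ℝ} (hf : ∀ i, CbOfDeg 2 (f i)) :
    ∃ B, 1 ≤ B ∧ ∀ i, SecondOrderBounds B (f i) := by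
  choose B hB using fun i => (hf i).exists_secondOrderBounds
  refine ⟨1 + ∑ i, |B i|, ?_, fun i => hB i _ ?_⟩
  · have := Finset.sum_nonneg fun i (_ : i ∈ Finset.univ) => abs_nonneg (B i)
    linarith
  · have := Finset.single_le_sum (f := fun j => |B j|) (fun j _ => abs_nonneg (B j)) (Finset.mem_univ i)
    have := le_abs_self (B i)
    linarith

theorem abs_integral_le_of_abs_le {g : ℝ → ℝ} {s t C : ℝ} (hst : s ≤ t)
    (h : ∀ v ∈ Icc s t, |g v| ≤ C) : |∫ v in s..t, g v| ≤ C * (t - s) := by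
  have := intervalIntegral.norm_integral_le_of_norm_le_const (f := g) (a := s) (b := t) (C := C)
    fun v hv => by
      rw [uIoc_of_le hst] at hv
      exact h v ⟨hv.1.le, hv.2⟩
  rwa [abs_of_nonneg (sub_nonneg.mpr hst)] at this

theorem abs_sum_le_card_mul {N : ℕ} {v : Fin N → ℝ} {r : ℝ} (h : ∀ i, |v i| ≤ r) :
    |∑ i, v i| ≤ N * r := by
  calc |∑ i, v i| ≤ ∑ i, |v i| := Finset.abs_sum_le_sum_abs _ _
    _ ≤ ∑ _i : Fin N, r := Finset.sum_le_sum fun i _ => h i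
    _ = N * r := by simp

/-- Local estimate of the defect of additivity of the second-order remainder. -/
theorem abs_defect_le {N : ℕ} {f : Fin N → ℝ → ℝ} {B A : ℝ} (hB : 1 ≤ B)
    (hf : ∀ i, SecondOrderBounds B (f i)) (hA : (N + 1) * B ≤ A)
    {v w μ r W : ℝ} {d e : Fin N → ℝ} {X Z : Fin N → Fin N → ℝ}
    (hW : 0 ≤ W) (hW1 : W ≤ 1) (hμ : 0 ≤ μ)
    (hd : ∀ i, |d i| ≤ W) (he : ∀ i, |e i| ≤ W)
    (hX : ∀ i j, |X i j| ≤ W ^ 2) (hZ : ∀ i j, |Z i j| ≤ W ^ 2)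
    (hvw : w - v = ∑ j, f j v * d j + ∑ i, ∑ j, f i v * deriv (f j) v * X i j + r + μ) :
    |∑ j, (f j w - f j v - deriv (f j) v * ∑ i, f i v * d i) * e j +
      ∑ i, ∑ j, (f i w * deriv (f j) w - f i v * deriv (f j) v) * Z i j| ≤
      6 * A ^ 4 * (W ^ 3 + (μ + |r|) * W) := by
  have hB0 : 0 ≤ B := by linarith
  have hN : (0 : ℝ) ≤ N := Nat.cast_nonneg N
  set P := ∑ j, f j v * d j with hP
  set R := ∑ i, ∑ j, f i v * deriv (f j) v * X i j + r + μ with hR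
  have hPle : |P| ≤ N * (B * W) := abs_sum_le_card_mul fun i => by
    rw [abs_mul]
    exact mul_le_mul ((hf i).value v) (hd i) (abs_nonneg _) hB0
  have hff : ∀ i j z, |f i z * deriv (f j) z| ≤ B * B := fun i j z => by
    rw [abs_mul]
    exact mul_le_mul ((hf i).value z) ((hf j).deriv_le z) (abs_nonneg _) hB0
  have hRle : |R| ≤ N * (N * (B * B * W ^ 2)) + (μ + |r|) := by
    have h1 : |∑ i, ∑ j, f i v * deriv (f j) v * X i j| ≤ N * (N * (B * B * W ^ 2)) :=
      abs_sum_le_card_mul fun i => abs_sum_le_card_mul fun j => by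
        rw [abs_mul]
        exact mul_le_mul (hff i j v) (hX i j) (abs_nonneg _) (by positivity)
    have h2 := abs_add_le (∑ i, ∑ j, f i v * deriv (f j) v * X i j + r) μ
    have h3 := abs_add_le (∑ i, ∑ j, f i v * deriv (f j) v * X i j) r
    rw [abs_of_nonneg hμ] at h2
    linarith
  have hw : w = v + P + R := by rw [hR]; linarith
  have hwv : |w - v| ≤ |P| + |R| := by
    rw [show w - v = P + R by rw [hw]; ring]; exact abs_add_le _ _
  set ρ := N * (N * (B * B * W ^ 2)) + (μ + |r|) with hρ
  have t1 : |∑ j, (f j w - f j v - deriv (f j) v * P) * e j| ≤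
      N * ((B * ρ + B * (N * (B * W)) ^ 2) * W) := by
    refine abs_sum_le_card_mul fun j => ?_
    rw [abs_mul]
    refine mul_le_mul ?_ (he j) (abs_nonneg _) (by positivity)
    have a1 := (hf j).lipschitz (v + P) w
    have a2 := (hf j).taylor v P
    rw [show w - (v + P) = R by rw [hw]; ring] at a1
    have a3 : |f j w - f j v - deriv (f j) v * P| ≤
        |f j w - f j (v + P)| + |f j (v + P) - f j v - deriv (f j) v * P| := by
      refine le_trans (le_of_eq ?_) (abs_add_le _ _)
      congr 1; ring
    have a4 : B * |R| ≤ B * ρ := mul_le_mul_of_nonneg_left hRle hB0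
    have a5 : B * P ^ 2 ≤ B * (N * (B * W)) ^ 2 := by
      rw [← sq_abs P]; gcongr
    linarith
  have t2 : |∑ i, ∑ j, (f i w * deriv (f j) w - f i v * deriv (f j) v) * Z i j| ≤
      N * (N * (2 * B * B * (N * (B * W) + ρ) * W ^ 2)) := by
    refine abs_sum_le_card_mul fun i => abs_sum_le_card_mul fun j => ?_
    rw [abs_mul]
    refine mul_le_mul ?_ (hZ i j) (abs_nonneg _) (by positivity)
    have a1 := mul_le_mul ((hf i).lipschitz v w) ((hf j).deriv_le w) (abs_nonneg _) (by positivity)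
    have a2 := mul_le_mul ((hf i).value v) ((hf j).deriv_lipschitz v w) (abs_nonneg _) hB0
    rw [← abs_mul] at a1 a2
    have a3 := abs_add_le ((f i w - f i v) * deriv (f j) w) (f i v * (deriv (f j) w - deriv (f j) v))
    rw [show (f i w - f i v) * deriv (f j) w + f i v * (deriv (f j) w - deriv (f j) v) =
      f i w * deriv (f j) w - f i v * deriv (f j) v by ring] at a3
    have a4 : 2 * B * B * |w - v| ≤ 2 * B * B * (N * (B * W) + ρ) :=
      mul_le_mul_of_nonneg_left (by linarith) (by positivity)
    linarith
  refine (abs_add_le _ _).trans ((add_le_add t1 t2).trans ?_)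
  have hNB : N * B ≤ A := by linarith
  have hBA : B ≤ A := by nlinarith
  have hA1 : 1 ≤ A := hB.trans hBA
  have hA0 : 0 ≤ A := by linarith
  set q := μ + |r| with hq
  have hq0 : 0 ≤ q := by positivity
  have hNB0 : 0 ≤ N * B := by positivity
  have hρ' : ρ = (N * B) ^ 2 * W ^ 2 + q := by rw [hρ]; ring
  have pw : ∀ k l : ℕ, k ≤ l → A ^ k ≤ A ^ l := fun k l hkl => pow_le_pow_right₀ hA1 hkl
  have hsum : N * ((B * ρ + B * (N * (B * W)) ^ 2) * W) +
      N * (N * (2 * B * B * (N * (B * W) + ρ) * W ^ 2)) =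
      (4 * (N * B) ^ 3 + 2 * (N * B) ^ 4 * W) * W ^ 3
        + (N * B + 2 * (N * B) ^ 2 * W) * (q * W) := by
    rw [hρ']; ring
  rw [hsum]
  have c1 : 4 * (N * B) ^ 3 + 2 * (N * B) ^ 4 * W ≤ 6 * A ^ 4 := by
    have e1 : (N * B) ^ 3 ≤ A ^ 4 := (pow_le_pow_left₀ hNB0 hNB 3).trans (pw 3 4 (by norm_num))
    have e2 : (N * B) ^ 4 * W ≤ A ^ 4 * 1 :=
      mul_le_mul (pow_le_pow_left₀ hNB0 hNB 4) hW1 hW (by positivity)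
    have e4 : 0 ≤ A ^ 4 := by positivity
    linarith
  have c2 : N * B + 2 * (N * B) ^ 2 * W ≤ 6 * A ^ 4 := by
    have e1 : N * B ≤ A ^ 4 := hNB.trans (by simpa using pw 1 4 (by norm_num))
    have e2 : (N * B) ^ 2 * W ≤ A ^ 4 * 1 :=
      mul_le_mul ((pow_le_pow_left₀ hNB0 hNB 2).trans (pw 2 4 (by norm_num))) hW1 hW (by positivity)
    have e4 : 0 ≤ A ^ 4 := by positivity
    linarith
  have := mul_le_mul_of_nonneg_right c1 (by positivity : 0 ≤ W ^ 3)
  have := mul_le_mul_of_nonneg_right c2 (by positivity : 0 ≤ q * W)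
  linarith

section Driver

variable {N : ℕ} {x : ℝ → Fin N → ℝ}

theorem continuous_deriv_coord (hx : ContDiff ℝ 1 x) (j : Fin N) :
    Continuous (deriv fun v => x v j) :=
  (contDiff_pi.mp hx j).continuous_deriv (by norm_num)

theorem integral_deriv_coord (hx : ContDiff ℝ 1 x) (j : Fin N) (s t : ℝ) :
    ∫ u in s..t, deriv (fun v => x v j) u = x t j - x s j :=
  intervalIntegral.integral_deriv_eq_sub
    (fun v _ => (contDiff_pi.mp hx j).differentiable (by norm_num) v)
    ((continuous_deriv_coord hx j).intervalIntegrable _ _)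

/-- Chen's relation. -/
theorem smoothLift_chen (hx : ContDiff ℝ 1 x) (s u t : ℝ) (i j : Fin N) :
    smoothLift x s t i j =
      smoothLift x s u i j + smoothLift x u t i j + (x u i - x s i) * (x t j - x u j) := by
  have hc := continuous_deriv_coord hx j
  have hxi : Continuous fun v => x v i := (contDiff_pi.mp hx i).continuous
  have hint : ∀ z a b, IntervalIntegrable (fun u => (x u i - x z i) * deriv (fun v => x v j) u)
      volume a b := fun z a b => ((hxi.sub continuous_const).mul hc).intervalIntegrable _ _
  have hint' : IntervalIntegrable (fun v' => (x u i - x s i) * deriv (fun v => x v j) v')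
      volume u t := (continuous_const.mul hc).intervalIntegrable _ _
  unfold smoothLift
  rw [← intervalIntegral.integral_add_adjacent_intervals (hint s s u) (hint s u t), add_assoc,
    ← integral_deriv_coord hx j u t, ← intervalIntegral.integral_const_mul,
    ← intervalIntegral.integral_add (hint u u t) hint']
  congr 1
  refine intervalIntegral.integral_congr fun v _ => ?_
  ring

end Driver

/-- Second-order remainder of a path `y` driven by `x` and pushed by `m`. -/
def reflectedRemainder {N : ℕ} (f : Fin N → ℝ → ℝ) (x : ℝ → Fin N → ℝ) (y m : ℝ → ℝ)
    (s t : ℝ) : ℝ :=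
  y t - y s - (m t - m s) - ∑ j, f j (y s) * (x t j - x s j) -
    ∑ i, ∑ j, f i (y s) * deriv (f j) (y s) * smoothLift x s t i j

theorem reflectedRemainder_defect {N : ℕ} (f : Fin N → ℝ → ℝ) {x : ℝ → Fin N → ℝ}
    (hx : ContDiff ℝ 1 x) (y m : ℝ → ℝ) (s u t : ℝ) :
    reflectedRemainder f x y m s t - reflectedRemainder f x y m s u -
        reflectedRemainder f x y m u t =
      ∑ j, (f j (y u) - f j (y s) - deriv (f j) (y s) * ∑ i, f i (y s) * (x u i - x s i)) *
          (x t j - x u j) +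
        ∑ i, ∑ j, (f i (y u) * deriv (f j) (y u) - f i (y s) * deriv (f j) (y s)) *
          smoothLift x u t i j := by
  have e1 : ∑ i, ∑ j, f i (y s) * deriv (f j) (y s) * smoothLift x s t i j =
      ∑ i, ∑ j, f i (y s) * deriv (f j) (y s) * smoothLift x s u i j +
      ∑ i, ∑ j, f i (y s) * deriv (f j) (y s) * smoothLift x u t i j +
      ∑ j, (deriv (f j) (y s) * ∑ i, f i (y s) * (x u i - x s i)) * (x t j - x u j) := by
    simp only [Finset.mul_sum, Finset.sum_mul]
    rw [Finset.sum_comm (f := fun j i => deriv (f j) (y s) * (f i (y s) * (x u i - x s i)) *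
      (x t j - x u j))]
    simp only [← Finset.sum_add_distrib]
    refine Finset.sum_congr rfl fun i _ => Finset.sum_congr rfl fun j _ => ?_
    rw [smoothLift_chen hx s u t]
    ring
  have e2 : ∑ j, f j (y s) * (x t j - x s j) =
      ∑ j, f j (y s) * (x t j - x u j) + ∑ j, f j (y s) * (x u j - x s j) := by
    rw [← Finset.sum_add_distrib]
    exact Finset.sum_congr rfl fun j _ => by ring
  unfold reflectedRemainder
  rw [e1, e2]
  simp only [sub_mul, Finset.sum_sub_distrib]
  ring

theorem abs_smoothLift_le {N : ℕ} {x : ℝ → Fin N → ℝ} (hx : ContDiff ℝ 1 x) {L s t : ℝ}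
    (hL : ∀ j, ∀ u ∈ Icc s t, |deriv (fun v => x v j) u| ≤ L) (hst : s ≤ t) (i j : Fin N) :
    |smoothLift x s t i j| ≤ L ^ 2 * (t - s) ^ 2 := by
  have hL0 : 0 ≤ L := (abs_nonneg _).trans (hL i s (left_mem_Icc.mpr hst))
  have hinc : ∀ u ∈ Icc s t, |x u i - x s i| ≤ L * (t - s) := fun u hu => by
    rw [← integral_deriv_coord hx i s u]
    refine (abs_integral_le_of_abs_le (C := L) hu.1
      fun v hv => hL i v ⟨hv.1, hv.2.trans hu.2⟩).trans ?_
    exact mul_le_mul_of_nonneg_left (by linarith [hu.2]) hL0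
  refine (abs_integral_le_of_abs_le (C := L * (t - s) * L) hst fun v hv => ?_).trans
    (le_of_eq (by ring))
  rw [abs_mul]
  exact mul_le_mul (hinc v hv) (hL j v hv) (abs_nonneg _) (mul_nonneg hL0 (by linarith))

/-- Qualitative smallness of the remainder for a smooth driver. -/
theorem exists_abs_reflectedRemainder_le {N : ℕ} {f : Fin N → ℝ → ℝ} {B : ℝ} (hB : 1 ≤ B)
    (hf : ∀ i, SecondOrderBounds B (f i)) {x : ℝ → Fin N → ℝ} (hx : ContDiff ℝ 1 x) {T : ℝ}
    {y m : ℝ → ℝ} (hy : ContinuousOn y (Icc 0 T)) (hm : MonotoneOn m (Icc 0 T))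
    (heq : ∀ s t, 0 ≤ s → s ≤ t → t ≤ T →
      y t - y s = (∑ i, ∫ u in s..t, f i (y u) * deriv (fun v => x v i) u) + (m t - m s)) :
    ∃ M, 0 ≤ M ∧ ∀ s t, 0 ≤ s → s ≤ t → t ≤ T →
      |reflectedRemainder f x y m s t| ≤ M * (t - s) * ((t - s) + (m t - m s)) := by
  have hB0 : 0 ≤ B := by linarith
  have hex : ∀ j, ∃ C, ∀ u ∈ Icc 0 T, ‖deriv (fun v => x v j) u‖ ≤ C := fun j =>
    isCompact_Icc.exists_bound_of_continuousOn (continuous_deriv_coord hx j).continuousOn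
  choose C hC using hex
  set L : ℝ := ∑ j, |C j| with hLdef
  have hL0 : 0 ≤ L := Finset.sum_nonneg fun j _ => abs_nonneg _
  have hL : ∀ j, ∀ u ∈ Icc 0 T, |deriv (fun v => x v j) u| ≤ L := fun j u hu =>
    (hC j u hu).trans ((le_abs_self _).trans
      (Finset.single_le_sum (f := fun j => |C j|) (fun j _ => abs_nonneg _) (Finset.mem_univ j)))
  have hm' : ∀ s t, 0 ≤ s → s ≤ t → t ≤ T → 0 ≤ m t - m s := fun s t h1 h2 h3 =>
    sub_nonneg.mpr (hm ⟨h1, h2.trans h3⟩ ⟨h1.trans h2, h3⟩ h2)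
  have hinc : ∀ s t, 0 ≤ s → s ≤ t → t ≤ T → |y t - y s| ≤ N * (B * L * (t - s)) + (m t - m s) := by
    intro s t h1 h2 h3
    rw [heq s t h1 h2 h3]
    refine (abs_add_le _ _).trans (add_le_add (abs_sum_le_card_mul fun j => ?_)
      (abs_of_nonneg (hm' s t h1 h2 h3)).le)
    refine abs_integral_le_of_abs_le h2 fun v hv => ?_
    rw [abs_mul]
    exact mul_le_mul ((hf j).value _) (hL j v ⟨h1.trans hv.1, hv.2.trans h3⟩) (abs_nonneg _) hB0
  refine ⟨N * (B * (N * B * L + 1) * L) + N * (N * (B * B * L ^ 2)), by positivity,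
    fun s t h1 h2 h3 => ?_⟩
  have hΔ := hm' s t h1 h2 h3
  have hts : 0 ≤ t - s := by linarith
  have hsub : Icc s t ⊆ Icc 0 T := Icc_subset_Icc h1 h3
  have hrep : reflectedRemainder f x y m s t =
      ∑ j, (∫ u in s..t, (f j (y u) - f j (y s)) * deriv (fun v => x v j) u) -
        ∑ i, ∑ j, f i (y s) * deriv (f j) (y s) * smoothLift x s t i j := by
    unfold reflectedRemainder
    rw [heq s t h1 h2 h3, add_sub_cancel_right, ← Finset.sum_sub_distrib]
    congr 1
    refine Finset.sum_congr rfl fun j _ => ?_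
    have hfc : Continuous (f j) := by
      refine (LipschitzWith.of_dist_le_mul (K := B.toNNReal) fun z w => ?_).continuous
      rw [Real.dist_eq, Real.dist_eq, Real.coe_toNNReal _ hB0]
      exact (hf j).lipschitz w z
    have hdc := continuous_deriv_coord hx j
    rw [← integral_deriv_coord hx j s t, ← intervalIntegral.integral_const_mul,
      ← intervalIntegral.integral_sub]
    · exact intervalIntegral.integral_congr fun u _ => by ring
    · refine ContinuousOn.intervalIntegrable ?_
      rw [uIcc_of_le h2]
      exact (hfc.comp_continuousOn (hy.mono hsub)).mul hdc.continuousOn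
    · exact (continuous_const.mul hdc).intervalIntegrable _ _
  rw [hrep]
  have b1 : |∑ j, (∫ u in s..t, (f j (y u) - f j (y s)) * deriv (fun v => x v j) u)| ≤
      N * (B * (N * (B * L * (t - s)) + (m t - m s)) * L * (t - s)) := by
    refine abs_sum_le_card_mul fun j => ?_
    refine abs_integral_le_of_abs_le h2 fun v hv => ?_
    rw [abs_mul]
    refine mul_le_mul (((hf j).lipschitz _ _).trans (mul_le_mul_of_nonneg_left
      ((hinc s v h1 hv.1 (hv.2.trans h3)).trans ?_) hB0))
      (hL j v ⟨h1.trans hv.1, hv.2.trans h3⟩) (abs_nonneg _) (by positivity)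
    have := hm' v t (h1.trans hv.1) hv.2 h3
    refine add_le_add ?_ (by linarith)
    have := hv.2
    gcongr
  have b2 : |∑ i, ∑ j, f i (y s) * deriv (f j) (y s) * smoothLift x s t i j| ≤
      N * (N * (B * B * (L ^ 2 * (t - s) ^ 2))) :=
    abs_sum_le_card_mul fun i => abs_sum_le_card_mul fun j => by
      rw [abs_mul, abs_mul]
      exact mul_le_mul (mul_le_mul ((hf i).value _) ((hf j).deriv_le _) (abs_nonneg _) hB0)
        (abs_smoothLift_le hx (fun j' u hu => hL j' u (hsub hu)) h2 i j) (abs_nonneg _)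
        (by positivity)
  refine (abs_sub _ _).trans ((add_le_add b1 b2).trans ?_)
  have z1 : 0 ≤ N * (B * L) * (t - s) * (t - s) := by positivity
  have z2 : 0 ≤ N * (B * (N * B * L)  * L) * (t - s) * (m t - m s) := by positivity
  have z3 : 0 ≤ N * (N * (B * B * L ^ 2)) * (t - s) * (m t - m s) := by positivity
  linarith

/-- The reflection term is constant on the last excursion away from zero: either it does not
increase on `[s, t]`, or all of its increase occurs before the last zero of `y`. -/
theorem exists_last_zero {T s t : ℝ} {y m : ℝ → ℝ} {μ : Measure ℝ}
    (hy : ContinuousOn y (Icc 0 T)) (hs : 0 ≤ s) (hst : s ≤ t) (htT : t ≤ T)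
    (hμ : ∀ s t, 0 ≤ s → s ≤ t → t ≤ T → μ (Ioc s t) = ENNReal.ofReal (m t - m s))
    (hμ0 : μ {u | u ∈ Ioc (0 : ℝ) T ∧ y u ≠ 0} = 0) :
    m t - m s ≤ 0 ∨ ∃ τ ∈ Icc s t, y τ = 0 ∧ m t - m τ ≤ 0 := by
  have hflat : ∀ r, 0 ≤ r → r ≤ t → (∀ u ∈ Ioc r t, y u ≠ 0) → m t - m r ≤ 0 := by
    intro r hr hrt hne
    have : μ (Ioc r t) = 0 := measure_mono_null
      (show Ioc r t ⊆ {u | u ∈ Ioc (0 : ℝ) T ∧ y u ≠ 0} from fun u hu =>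
        ⟨⟨hr.trans_lt hu.1, hu.2.trans htT⟩, hne u hu⟩) hμ0
    rw [hμ r t hr hrt htT] at this
    exact ENNReal.ofReal_eq_zero.mp this
  by_cases hex : ∃ u ∈ Icc s t, y u = 0
  · right
    have hcl : IsCompact (Icc s t ∩ y ⁻¹' {0}) :=
      isCompact_Icc.of_isClosed_subset ((hy.mono (Icc_subset_Icc hs htT)).preimage_isClosed_of_isClosed
        isClosed_Icc isClosed_singleton) inter_subset_left
    obtain ⟨u, hu, hu0⟩ := hex
    obtain ⟨τ, ⟨hτ, hτ0⟩, hmax⟩ := hcl.exists_isGreatest ⟨u, hu, hu0⟩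
    refine ⟨τ, hτ, hτ0, hflat τ (hs.trans hτ.1) hτ.2 fun v hv hv0 => ?_⟩
    have hvτ : v ≤ τ := hmax (show v ∈ Icc s t ∩ y ⁻¹' {0} from
      ⟨⟨hτ.1.trans hv.1.le, hv.2⟩, hv0⟩)
    exact absurd hvτ (not_le.mpr hv.1)
  · left
    exact hflat s hs hst fun u hu hu0 => hex ⟨u, ⟨hu.1.le, hu.2⟩, hu0⟩

theorem exists_sewing_constant {p : ℝ} (hp0 : 0 < p) (hp3 : p < 3) :
    ∃ K : ℝ, 1 ≤ K ∧ K * (2 : ℝ) ^ (1 - 3 / p) + 2 ≤ K := by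
  have hlt : (2 : ℝ) ^ (1 - 3 / p) < 1 := by
    refine Real.rpow_lt_one_of_one_lt_of_neg (by norm_num) ?_
    have : 1 < 3 / p := by rw [lt_div_iff₀ hp0]; linarith
    linarith
  have hpos : (0 : ℝ) < (2 : ℝ) ^ (1 - 3 / p) := by positivity
  have h1 : 0 < 1 - (2 : ℝ) ^ (1 - 3 / p) := by linarith
  generalize (2 : ℝ) ^ (1 - 3 / p) = z at *
  refine ⟨2 / (1 - z), ?_, le_of_eq ?_⟩
  · rw [le_div_iff₀ h1]; linarith
  · field_simp
    ring

theorem abs_le_of_norm_add_rpow_norm_le {N : ℕ} {d : Fin N → ℝ} {X : Fin N → Fin N → ℝ} {W : ℝ}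
    (h : ‖d‖ + ‖X‖ ^ ((1 : ℝ) / 2) ≤ W) :
    (∀ i, |d i| ≤ W) ∧ ∀ i j, |X i j| ≤ W ^ 2 := by
  have hX0 : 0 ≤ ‖X‖ ^ ((1 : ℝ) / 2) := by positivity
  refine ⟨fun i => (norm_le_pi_norm d i).trans (by linarith), fun i j => ?_⟩
  have h1 : ‖X‖ ≤ W ^ 2 := by
    have h2 : ‖X‖ ^ ((1 : ℝ) / 2) ≤ W := by
      have := norm_nonneg d
      linarith
    calc ‖X‖ = (‖X‖ ^ ((1 : ℝ) / 2)) ^ 2 := by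
          rw [← Real.sqrt_eq_rpow, Real.sq_sqrt (norm_nonneg _)]
      _ ≤ W ^ 2 := pow_le_pow_left₀ hX0 h2 2
  exact ((norm_le_pi_norm (X i) j).trans (norm_le_pi_norm X i)).trans h1

/-- **Uniform local bound on the reflection measure of reflected ODEs** (Step 2 of the
proof of Theorem 4.1): there are constants `ε₀, C > 0` depending only on `f ∈ C²_b` and
`p ∈ [2,3)` such that for any `C¹` driver `x` controlled, together with its step-2 lift,
by a regular control `ω`, and any solution `(y,m)` of the reflected ODE driven by `x`,
one has `δm_{st} ≤ C ω(s,t)^{1/p}` on every interval `I ⊆ [0,T]` with `ω(I) ≤ ε₀`. -/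
theorem reflected_ode_measure_local_bound
    (N : ℕ) (p : ℝ) (hp2 : 2 ≤ p) (hp3 : p < 3)
    (f : Fin N → ℝ → ℝ) (hf : ∀ i, CbOfDeg 2 (f i)) :
    ∃ ε₀ : ℝ, 0 < ε₀ ∧ ∃ C : ℝ, 0 < C ∧
      ∀ (T a : ℝ), 0 < T → 0 ≤ a →
      ∀ (x : ℝ → Fin N → ℝ), ContDiff ℝ 1 x →
      ∀ (ω : ℝ → ℝ → ℝ), IsRegularControl 0 T ω →
        (∀ s t, 0 ≤ s → s ≤ t → t ≤ T →
          ‖(fun i => x t i - x s i)‖ + ‖(fun i j => smoothLift x s t i j)‖ ^ ((1:ℝ)/2)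
            ≤ ω s t ^ (1 / p)) →
      ∀ (y m : ℝ → ℝ) (μ : MeasureTheory.Measure ℝ), SolvesReflectedODE T f x a y m μ →
      ∀ a' b', 0 ≤ a' → a' ≤ b' → b' ≤ T → ω a' b' ≤ ε₀ →
      ∀ s t, a' ≤ s → s ≤ t → t ≤ b' →
        m t - m s ≤ C * ω s t ^ (1 / p) := by
  have hp0 : 0 < p := by linarith
  have h1p : 0 < 1 / p := by positivity
  obtain ⟨B, hB, hfB⟩ := exists_forall_secondOrderBounds hf
  obtain ⟨K, hK1, hKp⟩ := exists_sewing_constant hp0 hp3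
  set A : ℝ := (N + 1) * B with hA
  have hN : (0 : ℝ) ≤ N := Nat.cast_nonneg N
  have hA1 : 1 ≤ A := by
    have : 0 ≤ N * B := by positivity
    rw [hA, add_mul]; linarith
  have hNB : N * B ≤ A := by rw [hA, add_mul]; linarith
  set c : ℝ := 6 * A ^ 4 with hc
  have hc1 : 1 ≤ c := by
    have := one_le_pow₀ hA1 (n := 4)
    linarith
  set D : ℝ := 16 * K * c with hD
  have hKc : 1 ≤ K * c := one_le_mul_of_one_le_of_one_le hK1 hc1
  have hD1 : 16 ≤ D := by rw [hD, mul_assoc]; linarith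
  set ε : ℝ := (1 / (2 * D)) ^ p with hε
  have hq0 : 0 < 1 / (2 * D) := by positivity
  have hq1 : 1 / (2 * D) ≤ 1 := by rw [div_le_one (by linarith)]; linarith
  have hε0 : 0 < ε := by positivity
  have hε1 : ε ≤ 1 := Real.rpow_le_one hq0.le hq1 hp0.le
  have hεp : ε ^ (1 / p) = 1 / (2 * D) := by
    rw [hε, ← Real.rpow_mul hq0.le, mul_one_div_cancel hp0.ne', Real.rpow_one]
  refine ⟨ε / 2, by positivity, 2 * (A + A ^ 2 + D), by positivity, ?_⟩
  intro T a _ _ x hx ω hω hωx y m μ hsol a' b' ha' hab hb' hωε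
  obtain ⟨hy, hy0, -, hm, -, -, -, heq, hμ, hμ0⟩ := hsol
  obtain ⟨M, hM0, hM⟩ := exists_abs_reflectedRemainder_le hB hfB hx hy hm heq
  have hsub : Icc a' b' ⊆ Icc 0 T := Icc_subset_Icc ha' hb'
  have hω' : IsControl a' b' ω :=
    ⟨fun s t h1 h2 h3 => hω.1.1 s t (ha'.trans h1) h2 (h3.trans hb'),
      fun s u t h1 h2 h3 h4 => hω.1.2 s u t (ha'.trans h1) h2 h3 (h4.trans hb')⟩
  have hωlt : ω a' b' < ε := by linarith
  have hWε : ∀ s t, a' ≤ s → s ≤ t → t ≤ b' → ω s t ^ (1 / p) ≤ 1 / (2 * D) :=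
    fun s t h1 h2 h3 => by
      rw [← hεp]
      exact Real.rpow_le_rpow (hω'.1 s t h1 h2 h3)
        ((hω'.mono le_rfl h1 h2 h3 le_rfl).trans hωlt.le) h1p.le
  have hW3 : ∀ s t, a' ≤ s → s ≤ t → t ≤ b' → ω s t ^ (3 / p) = (ω s t ^ (1 / p)) ^ 3 :=
    fun s t h1 h2 h3 => by
      rw [← Real.rpow_natCast, ← Real.rpow_mul (hω'.1 s t h1 h2 h3)]
      congr 1
      push_cast
      ring
  have hWmono : ∀ s s' t' t, a' ≤ s → s ≤ s' → s' ≤ t' → t' ≤ t → t ≤ b' →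
      ω s' t' ^ (1 / p) ≤ ω s t ^ (1 / p) := fun s s' t' t h1 h2 h3 h4 h5 =>
    Real.rpow_le_rpow (hω'.1 s' t' (h1.trans h2) h3 (h4.trans h5)) (hω'.mono h1 h2 h3 h4 h5) h1p.le
  have hbd : ∀ s s' t' t, a' ≤ s → s ≤ s' → s' ≤ t' → t' ≤ t → t ≤ b' →
      (∀ i, |x t' i - x s' i| ≤ ω s t ^ (1 / p)) ∧
        ∀ i j, |smoothLift x s' t' i j| ≤ (ω s t ^ (1 / p)) ^ 2 :=
    fun s s' t' t h1 h2 h3 h4 h5 => abs_le_of_norm_add_rpow_norm_le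
      ((hωx s' t' (ha'.trans (h1.trans h2)) h3 (h4.trans (h5.trans hb'))).trans
        (hWmono s s' t' t h1 h2 h3 h4 h5))
  have hrem : ∀ s t, a' ≤ s → s ≤ t → t ≤ b' → |reflectedRemainder f x y m s t| ≤
      D * (ω s t ^ (3 / p) + (m t - m s) * ω s t ^ (1 / p)) := by
    intro s t h1 h2 h3
    refine abs_remainder_le hp2 (by linarith) (by linarith) hKp hω' (hm.mono hsub) ?_ hM0
      (fun s t h1 h2 h3 => hM s t (ha'.trans h1) h2 (h3.trans hb')) hab hωlt hε1 ?_ h1 h2 h3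
    · intro s u t h1 h2 h3 h4
      rw [reflectedRemainder_defect f hx, hW3 s t h1 (h2.trans h3) h4]
      obtain ⟨d1, d2⟩ := hbd s s u t h1 le_rfl h2 h3 h4
      obtain ⟨d3, d4⟩ := hbd s u t t h1 h2 h3 le_rfl h4
      refine abs_defect_le hB hfB hA.ge (Real.rpow_nonneg (hω'.1 s t h1 (h2.trans h3) h4) _)
        ((hWε s t h1 (h2.trans h3) h4).trans hq1)
        (sub_nonneg.mpr (hm ⟨ha'.trans h1, h2.trans (h3.trans (h4.trans hb'))⟩
          ⟨ha'.trans (h1.trans h2), h3.trans (h4.trans hb')⟩ h2)) d1 d3 d2 d4 ?_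
      unfold reflectedRemainder
      ring
    · rw [hεp, hD]
      have : 0 < K * c := by linarith
      rw [mul_one_div, div_le_iff₀ (by positivity)]
      linarith
  intro s t hs hst ht
  have hW0 : 0 ≤ ω s t ^ (1 / p) := Real.rpow_nonneg (hω'.1 s t hs hst ht) _
  rcases exists_last_zero hy (ha'.trans hs) hst (ht.trans hb') hμ hμ0 with h0 | ⟨τ, hτ, hyτ, hmτ⟩
  · exact h0.trans (by positivity)
  have hτb : τ ≤ b' := hτ.2.trans ht
  set W := ω s τ ^ (1 / p) with hW
  have hWnn : 0 ≤ W := Real.rpow_nonneg (hω'.1 s τ hs hτ.1 hτb) _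
  have hWle : W ≤ 1 / (2 * D) := hWε s τ hs hτ.1 hτb
  have hW1 : W ≤ 1 := hWle.trans hq1
  have hΔ : 0 ≤ m τ - m s := sub_nonneg.mpr
    (hm ⟨ha'.trans hs, hst.trans (ht.trans hb')⟩ ⟨ha'.trans (hs.trans hτ.1), hτb.trans hb'⟩ hτ.1)
  have hr := hrem s τ hs hτ.1 hτb
  rw [hW3 s τ hs hτ.1 hτb] at hr
  obtain ⟨d1, d2⟩ := hbd s s τ τ hs le_rfl hτ.1 le_rfl hτb
  have hys := hy0 s ⟨ha'.trans hs, hst.trans (ht.trans hb')⟩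
  have s1 : |∑ j, f j (y s) * (x τ j - x s j)| ≤ N * (B * W) := abs_sum_le_card_mul fun j => by
    rw [abs_mul]
    exact mul_le_mul ((hfB j).value _) (d1 j) (abs_nonneg _) (by linarith)
  have s2 : |∑ i, ∑ j, f i (y s) * deriv (f j) (y s) * smoothLift x s τ i j| ≤
      N * (N * (B * B * W ^ 2)) := abs_sum_le_card_mul fun i => abs_sum_le_card_mul fun j => by
    rw [abs_mul, abs_mul]
    exact mul_le_mul (mul_le_mul ((hfB i).value _) ((hfB j).deriv_le _) (abs_nonneg _)
      (by linarith)) (d2 i j) (abs_nonneg _) (by positivity)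
  have hdecomp : m τ - m s = y τ - y s - ∑ j, f j (y s) * (x τ j - x s j) -
      ∑ i, ∑ j, f i (y s) * deriv (f j) (y s) * smoothLift x s τ i j -
      reflectedRemainder f x y m s τ := by
    unfold reflectedRemainder
    ring
  have b1 : N * (B * W) ≤ A * W := by
    rw [← mul_assoc]; exact mul_le_mul_of_nonneg_right hNB hWnn
  have b2 : N * (N * (B * B * W ^ 2)) ≤ A ^ 2 * W := by
    calc N * (N * (B * B * W ^ 2)) = (N * B) ^ 2 * (W * W) := by ring
      _ ≤ A ^ 2 * (W * 1) := by gcongr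
      _ = A ^ 2 * W := by ring
  have b3 : D * W ^ 3 ≤ D * W := by
    refine mul_le_mul_of_nonneg_left ?_ (by linarith)
    simpa using pow_le_pow_of_le_one hWnn hW1 (show 1 ≤ 3 by norm_num)
  have b4 : D * ((m τ - m s) * W) ≤ 1 / 2 * (m τ - m s) := by
    have : D * W ≤ 1 / 2 := by
      rw [le_div_iff₀ (by linarith)] at hWle
      linarith
    have := mul_le_mul_of_nonneg_right this hΔ
    linarith
  have hfin : m τ - m s ≤ 2 * (A + A ^ 2 + D) * W := by
    have a1 := (abs_le.mp s1).1
    have a2 := (abs_le.mp s2).1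
    have a3 := (abs_le.mp hr).1
    linarith
  have hlast : 2 * (A + A ^ 2 + D) * W ≤ 2 * (A + A ^ 2 + D) * ω s t ^ (1 / p) :=
    mul_le_mul_of_nonneg_left (hWmono s s τ t hs le_rfl hτ.1 hτ.2 ht) (by positivity)
  linarith

end
end
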